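/- Let (Ω₂,ℙ₂) be a probability space, let (W_n) be a tight sequence of P-variables W_n : [0,1] × [0,1] × Ω₂ → ℝ ([0,1] with Lebesgue measure), and let (W̃_n) be the sequence of associated probability graphons. If (W_n) is a Cauchy sequence with respect to the P-variables metric d_M, then (W̃_n) is a Cauchy sequence with respect to the unlabelled cut distance δ_□. -/

import Mathlib

set_option autoImplicit false

open MeasureTheory Set
open scoped ENNReal NNReal

noncomputable section

/-- `ℝ^n` with the Euclidean metric. -/
abbrev RE (n : ℕ) : Type := EuclideanSpace ℝ (Fin n)

/-- The random vector `(f₁(x₁), f₁(x₂), …, f_k(x₁), f_k(x₂), W(x₁,x₂,x₁₂))`. -/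
def sVec {Ω₁ Ω₂ : Type*} (k : ℕ) (f : Fin k → Ω₁ → ℝ)
    (W : Ω₁ × Ω₁ × Ω₂ → ℝ) (x : Ω₁ × Ω₁ × Ω₂) : RE (2 * k + 1) :=
  (WithLp.equiv 2 (Fin (2 * k + 1) → ℝ)).symm fun i =>
    if _ : (i : ℕ) < 2 * k then
      if (i : ℕ) % 2 = 0 then f ⟨(i : ℕ) / 2, by omega⟩ x.1
      else f ⟨(i : ℕ) / 2, by omega⟩ x.2.1
    else W x

/-- `S(f₁,…,f_k,W)`: the pushforward of the product measure `P₁ ⊗ P₁ ⊗ P₂` under `sVec`. -/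
def Smeasure {Ω₁ Ω₂ : Type*} [MeasurableSpace Ω₁] [MeasurableSpace Ω₂]
    (P₁ : Measure Ω₁) (P₂ : Measure Ω₂) {k : ℕ} (f : Fin k → Ω₁ → ℝ)
    (W : Ω₁ × Ω₁ × Ω₂ → ℝ) : Measure (RE (2 * k + 1)) :=
  (P₁.prod (P₁.prod P₂)).map (sVec k f W)

/-- The `k`-profile `S_k(W)`. -/
def SkSet {Ω₁ Ω₂ : Type*} [MeasurableSpace Ω₁] [MeasurableSpace Ω₂]
    (P₁ : Measure Ω₁) (P₂ : Measure Ω₂) (k : ℕ)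
    (W : Ω₁ × Ω₁ × Ω₂ → ℝ) : Set (Measure (RE (2 * k + 1))) :=
  {μ | ∃ f : Fin k → Ω₁ → ℝ, (∀ i, Measurable (f i)) ∧
    (∀ i x, f i x ∈ Icc (-1 : ℝ) 1) ∧ μ = Smeasure P₁ P₂ f W}

/-- A function partition: `{0,1}`-valued measurable functions summing to `1`. -/
def IsFunctionPartition {Ω₁ : Type*} [MeasurableSpace Ω₁] {k : ℕ}
    (f : Fin k → Ω₁ → ℝ) : Prop :=
  (∀ i, Measurable (f i)) ∧ (∀ i x, f i x = 0 ∨ f i x = 1) ∧ ∀ x, ∑ i, f i x = 1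

/-- The restricted `k`-profile `S'_k(W)`. -/
def SkSet' {Ω₁ Ω₂ : Type*} [MeasurableSpace Ω₁] [MeasurableSpace Ω₂]
    (P₁ : Measure Ω₁) (P₂ : Measure Ω₂) (k : ℕ)
    (W : Ω₁ × Ω₁ × Ω₂ → ℝ) : Set (Measure (RE (2 * k + 1))) :=
  {μ | ∃ f : Fin k → Ω₁ → ℝ, IsFunctionPartition f ∧ μ = Smeasure P₁ P₂ f W}

/-- Hausdorff edistance (w.r.t. the Lévy–Prokhorov distance) between sets of measures. -/
def eHausLP {X : Type*} [MeasurableSpace X] [PseudoEMetricSpace X]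
    (A B : Set (Measure X)) : ℝ≥0∞ :=
  max (⨆ μ ∈ A, ⨅ ν ∈ B, levyProkhorovEDist μ ν)
      (⨆ ν ∈ B, ⨅ μ ∈ A, levyProkhorovEDist μ ν)

/-- Hausdorff distance (w.r.t. the Lévy–Prokhorov distance) between sets of measures. -/
def dHLP {X : Type*} [MeasurableSpace X] [PseudoEMetricSpace X]
    (A B : Set (Measure X)) : ℝ := (eHausLP A B).toReal

/-- A `P`-variable: a measurable real-valued function on a product `Ω₁ × Ω₁ × Ω₂`
of probability spaces. -/
structure PVar where
  (Ω₁ : Type*)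
  (Ω₂ : Type*)
  [m₁ : MeasurableSpace Ω₁]
  [m₂ : MeasurableSpace Ω₂]
  (P₁ : Measure Ω₁)
  (P₂ : Measure Ω₂)
  (prob₁ : IsProbabilityMeasure P₁)
  (prob₂ : IsProbabilityMeasure P₂)
  (W : Ω₁ × Ω₁ × Ω₂ → ℝ)
  (meas : Measurable W)

attribute [instance] PVar.m₁ PVar.m₂

/-- The underlying product probability measure of a `P`-variable. -/
def PVar.vol (V : PVar) : Measure (V.Ω₁ × V.Ω₁ × V.Ω₂) := V.P₁.prod (V.P₁.prod V.P₂)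

/-- The `k`-profile of a `P`-variable. -/
def PVar.Sk (V : PVar) (k : ℕ) : Set (Measure (RE (2 * k + 1))) := SkSet V.P₁ V.P₂ k V.W

/-- The restricted `k`-profile of a `P`-variable. -/
def PVar.Sk' (V : PVar) (k : ℕ) : Set (Measure (RE (2 * k + 1))) := SkSet' V.P₁ V.P₂ k V.W

/-- The `P`-variables metric `d_M`. -/
def dM (V U : PVar) : ℝ :=
  ∑' k : ℕ, (2 : ℝ)⁻¹ ^ (k + 1) * dHLP (V.Sk (k + 1)) (U.Sk (k + 1))


/-- The probability graphon (Markov kernel `[0,1]² → 𝒫(ℝ)`) associated to a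
P-variable on `[0,1] × [0,1] × Ω₂`: `W̃(x₁,x₂;·)` is the law of `W(x₁,x₂,·)`. -/
def assocGraphon {Ω₂ : Type*} [MeasurableSpace Ω₂] (P₂ : Measure Ω₂)
    (W : unitInterval × unitInterval × Ω₂ → ℝ)
    (x : unitInterval × unitInterval) : Measure ℝ :=
  P₂.map fun ω => W (x.1, x.2, ω)

/-- `W̃(A;·) = ∫_A W̃(x,y;·) dx dy` for measurable `A ⊆ [0,1]²`. -/
def graphonInt (K : unitInterval × unitInterval → Measure ℝ)
    (A : Set (unitInterval × unitInterval)) : Measure ℝ :=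
  (((volume : Measure unitInterval).prod volume).restrict A).bind K

/-- The cut semidistance `d_□` between two probability graphons on `[0,1]`:
`sup_{S,T} d_LP(K(S×T;·), L(S×T;·))` over measurable `S, T ⊆ [0,1]`. -/
def cutDistKer (K L : unitInterval × unitInterval → Measure ℝ) : ℝ :=
  ⨆ p : {S : Set unitInterval // MeasurableSet S} ×
        {T : Set unitInterval // MeasurableSet T},
    levyProkhorovDist (graphonInt K (p.1.1 ×ˢ p.2.1)) (graphonInt L (p.1.1 ×ˢ p.2.1))

/-- The unlabelled cut distance `δ_□`: infimum of `d_□(K, L∘(φ×φ))` over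
Lebesgue-measure-preserving bijections `φ` of `[0,1]`. -/
def unlabCutDist (K L : unitInterval × unitInterval → Measure ℝ) : ℝ :=
  ⨅ φ : {φ : unitInterval ≃ᵐ unitInterval //
          MeasurePreserving φ (volume : Measure unitInterval) volume},
    cutDistKer K fun x => L (φ.1 x.1, φ.1 x.2)

/-- A P-variable on `[0,1] × [0,1] × Ω₂` (with Lebesgue measure on `[0,1]`),
bundled as a `PVar`. -/
def PVar.ofUnitInterval {Ω₂ : Type*} [MeasurableSpace Ω₂] (P₂ : Measure Ω₂)
    [h₂ : IsProbabilityMeasure P₂] (W : unitInterval × unitInterval × Ω₂ → ℝ)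
    (hW : Measurable W) : PVar :=
  ⟨unitInterval, Ω₂, (volume : Measure unitInterval), P₂, inferInstance, h₂, W, hW⟩



lemma lp_int {X : Type*} [MeasurableSpace X] [PseudoEMetricSpace X] [OpensMeasurableSpace X]
    (μ ν : Measure X) [IsProbabilityMeasure μ] [IsProbabilityMeasure ν] (ρ : ℝ) (hρ : 0 < ρ)
    (h : levyProkhorovEDist μ ν < ENNReal.ofReal ρ) (F : X → ℝ) (hF : Measurable F) (M : ℝ)
    (h0 : ∀ x, 0 ≤ F x) (hM : ∀ x, F x ≤ M) (D : Set X) (hDm : MeasurableSet D)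
    (hD0 : μ Dᶜ = 0) (s : ℝ) (hs : 0 ≤ s)
    (hD : ∀ x ∈ D, ∀ y, edist x y < ENNReal.ofReal ρ → F x ≤ F y + s) :
    ∫ x, F x ∂μ ≤ ∫ x, F x ∂ν + s + M * ρ := by
  have hM0 : 0 ≤ M := by
    obtain ⟨x⟩ : Nonempty X := by
      by_contra hne
      rw [not_nonempty_iff] at hne
      have h1 : μ univ = 1 := measure_univ
      rw [Set.univ_eq_empty_iff.2 hne] at h1
      simp at h1
    exact (h0 x).trans (hM x)
  have intν : Integrable F ν := Integrable.of_bound hF.aestronglyMeasurable M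
    (Filter.Eventually.of_forall fun x => by rw [Real.norm_eq_abs, abs_of_nonneg (h0 x)]; exact hM x)
  have key : ∫⁻ x, ENNReal.ofReal (F x) ∂μ ≤
      ∫⁻ x, ENNReal.ofReal (F x + s) ∂ν + ENNReal.ofReal (M * ρ) := by
    rw [lintegral_eq_lintegral_meas_le μ (Filter.Eventually.of_forall h0) hF.aemeasurable,
      lintegral_eq_lintegral_meas_le ν
        (Filter.Eventually.of_forall fun x => add_nonneg (h0 x) hs) (hF.add_const s).aemeasurable]
    have e1 : ∫⁻ t in Ioi (0:ℝ), μ {a | t ≤ F a} ≤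
        ∫⁻ t in Ioi (0:ℝ), (ν {a | t ≤ F a + s} + (Ioc 0 M).indicator (fun _ => ENNReal.ofReal ρ) t) := by
      refine setLIntegral_mono' measurableSet_Ioi fun t ht => ?_
      by_cases htM : t ≤ M
      · have : (Ioc 0 M).indicator (fun _ => ENNReal.ofReal ρ) t = ENNReal.ofReal ρ :=
          indicator_of_mem (show t ∈ Ioc 0 M from ⟨ht, htM⟩) _
        rw [this]
        have hB : MeasurableSet ({a | t ≤ F a} ∩ D) :=
          (measurableSet_le measurable_const hF).inter hDm
        calc μ {a | t ≤ F a} ≤ μ ({a | t ≤ F a} ∩ D) + μ Dᶜ := by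
              refine (measure_mono ?_).trans (measure_union_le _ _)
              intro x hx
              by_cases hxD : x ∈ D
              · exact Or.inl ⟨hx, hxD⟩
              · exact Or.inr hxD
          _ = μ ({a | t ≤ F a} ∩ D) := by rw [hD0, add_zero]
          _ ≤ _ := left_measure_le_of_levyProkhorovEDist_lt h hB
          _ ≤ _ := by
              gcongr
              rw [ENNReal.toReal_ofReal hρ.le]
              intro y hy
              rw [Metric.mem_thickening_iff_exists_edist_lt] at hy
              obtain ⟨x, hx, hxy⟩ := hy
              rw [edist_comm] at hxy
              exact le_trans hx.1 (hD x hx.2 y hxy)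
      · have : {a | t ≤ F a} = ∅ := by
          ext x; simp only [mem_ofPred_eq, mem_empty_iff_false, iff_false, not_le]
          exact (hM x).trans_lt (not_le.1 htM)
        rw [this]; simp
    refine e1.trans ?_
    rw [lintegral_add_right _ (measurable_const.indicator measurableSet_Ioc)]
    gcongr
    calc _ ≤ ∫⁻ t, (Ioc 0 M).indicator (fun _ => ENNReal.ofReal ρ) t := setLIntegral_le_lintegral _ _
      _ = _ := by
        rw [lintegral_indicator measurableSet_Ioc]
        simp
        rw [mul_comm, ENNReal.ofReal_mul hM0]
  rw [integral_eq_lintegral_of_nonneg_ae (Filter.Eventually.of_forall h0) hF.aestronglyMeasurable]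
  have e2 : ∫⁻ x, ENNReal.ofReal (F x + s) ∂ν = ENNReal.ofReal (∫ x, F x ∂ν + s) := by
    rw [← ofReal_integral_eq_lintegral_ofReal (f := fun x => F x + s) (intν.add (integrable_const s))
      (Filter.Eventually.of_forall fun x => add_nonneg (h0 x) hs),
      integral_add intν (integrable_const s)]
    simp
  rw [e2, ← ENNReal.ofReal_add (add_nonneg (integral_nonneg h0) hs) (by positivity)] at key
  exact ENNReal.toReal_le_of_le_ofReal
    (add_nonneg (add_nonneg (integral_nonneg h0) hs) (by positivity)) key

lemma sVec_meas {Ω₁ Ω₂ : Type*} [MeasurableSpace Ω₁] [MeasurableSpace Ω₂] {k : ℕ}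
    (f : Fin k → Ω₁ → ℝ) (hf : ∀ i, Measurable (f i)) (W : Ω₁ × Ω₁ × Ω₂ → ℝ) (hW : Measurable W) :
    Measurable (sVec k f W) := by
  refine (WithLp.measurable_toLp 2 (Fin (2 * k + 1) → ℝ)).comp (measurable_pi_lambda _ fun i => ?_)
  split_ifs
  · exact (hf _).comp measurable_fst
  · exact (hf _).comp (measurable_fst.comp measurable_snd)
  · exact hW

lemma Smeasure_prob {Ω₂ : Type*} [MeasurableSpace Ω₂] (P₂ : Measure Ω₂) [IsProbabilityMeasure P₂]
    {k : ℕ} (f : Fin k → unitInterval → ℝ) (hf : ∀ i, Measurable (f i))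
    (W : unitInterval × unitInterval × Ω₂ → ℝ) (hW : Measurable W) :
    IsProbabilityMeasure (Smeasure volume P₂ f W) :=
  Measure.isProbabilityMeasure_map (sVec_meas f hf W hW).aemeasurable

lemma haus_transfer {Ω₂ : Type*} [MeasurableSpace Ω₂] (P₂ : Measure Ω₂) [IsProbabilityMeasure P₂]
    (W : ℕ → unitInterval × unitInterval × Ω₂ → ℝ) (hW : ∀ n, Measurable (W n))
    (hcauchy : ∀ ε > (0 : ℝ), ∃ N : ℕ, ∀ m ≥ N, ∀ n ≥ N,
      dM (PVar.ofUnitInterval P₂ (W m) (hW m))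
         (PVar.ofUnitInterval P₂ (W n) (hW n)) < ε) (k : ℕ) (ρ : ℝ) (hρ : 0 < ρ) :
    ∃ N : ℕ, ∀ m ≥ N, ∀ n ≥ N, ∀ f : Fin (k+1) → unitInterval → ℝ, (∀ i, Measurable (f i)) →
      (∀ i x, f i x ∈ Icc (-1 : ℝ) 1) → ∃ g : Fin (k+1) → unitInterval → ℝ, (∀ i, Measurable (g i)) ∧
      (∀ i x, g i x ∈ Icc (-1 : ℝ) 1) ∧
      levyProkhorovEDist (Smeasure volume P₂ f (W m)) (Smeasure volume P₂ g (W n))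
        < ENNReal.ofReal ρ := by
  obtain ⟨N, hN⟩ := hcauchy ((2:ℝ)⁻¹ ^ (k+1) * ρ) (by positivity)
  refine ⟨N, fun m hm n hn f hf hf1 => ?_⟩
  have hd := hN m hm n hn
  set V := PVar.ofUnitInterval P₂ (W m) (hW m)
  set U := PVar.ofUnitInterval P₂ (W n) (hW n)
  have zero_mem : ∀ (k : ℕ) (n : ℕ), (Smeasure volume P₂ (fun (_ : Fin k) (_ : unitInterval) => (0:ℝ)) (W n))
      ∈ SkSet volume P₂ k (W n) := fun k n => ⟨_, fun _ => measurable_const, fun _ _ => by simp, rfl⟩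
  have univ_le : ∀ (k n : ℕ), ∀ μ ∈ SkSet volume P₂ k (W n), μ univ ≤ 1 := by
    rintro k n μ ⟨f, hf, -, rfl⟩
    have := Smeasure_prob P₂ f hf (W n) (hW n)
    exact prob_le_one
  have hle : ∀ k, eHausLP (V.Sk k) (U.Sk k) ≤ 1 := by
    intro k
    refine max_le (iSup₂_le fun μ hμ => ?_) (iSup₂_le fun μ hμ => ?_)
    · exact (iInf₂_le _ (zero_mem k n)).trans ((levyProkhorovEDist_le_max_measure_univ _ _).trans
        (max_le (univ_le k m μ hμ) (univ_le k n _ (zero_mem k n))))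
    · exact (iInf₂_le _ (zero_mem k m)).trans ((levyProkhorovEDist_le_max_measure_univ _ _).trans
        (max_le (univ_le k m _ (zero_mem k m)) (univ_le k n μ hμ)))
  have hle' : ∀ k, dHLP (V.Sk k) (U.Sk k) ≤ 1 := fun k => by
    have := ENNReal.toReal_mono ENNReal.one_ne_top (hle k)
    simpa [dHLP] using this
  have hsum : Summable fun k : ℕ => (2 : ℝ)⁻¹ ^ (k + 1) * dHLP (V.Sk (k + 1)) (U.Sk (k + 1)) := by
    refine Summable.of_nonneg_of_le (fun k => mul_nonneg (by positivity) ENNReal.toReal_nonneg)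
      (fun k => mul_le_of_le_one_right (by positivity) (hle' _)) ?_
    exact (summable_nat_add_iff 1).2 (summable_geometric_of_lt_one (by norm_num) (by norm_num))
  have h1 : (2 : ℝ)⁻¹ ^ (k + 1) * dHLP (V.Sk (k + 1)) (U.Sk (k + 1)) < (2:ℝ)⁻¹ ^ (k+1) * ρ :=
    (hsum.le_tsum k (fun j _ => mul_nonneg (by positivity) ENNReal.toReal_nonneg)).trans_lt hd
  have h2 : dHLP (V.Sk (k + 1)) (U.Sk (k + 1)) < ρ := lt_of_mul_lt_mul_left h1 (by positivity)
  have h3 : eHausLP (V.Sk (k + 1)) (U.Sk (k + 1)) < ENNReal.ofReal ρ := by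
    rw [ENNReal.lt_ofReal_iff_toReal_lt (ne_top_of_le_ne_top ENNReal.one_ne_top (hle _))]
    exact h2
  have h4 : (⨅ ν ∈ SkSet volume P₂ (k+1) (W n),
      levyProkhorovEDist (Smeasure volume P₂ f (W m)) ν) < ENNReal.ofReal ρ := by
    refine lt_of_le_of_lt ?_ h3
    refine le_trans ?_ (le_max_left _ _)
    exact le_iSup₂ (f := fun μ (_ : μ ∈ V.Sk (k+1)) => ⨅ ν ∈ U.Sk (k+1), levyProkhorovEDist μ ν)
      (Smeasure volume P₂ f (W m)) ⟨f, hf, hf1, rfl⟩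
  simp only [iInf_lt_iff] at h4
  obtain ⟨ν, ⟨g, hg, hg1, rfl⟩, h5⟩ := h4
  exact ⟨g, hg, hg1, h5⟩


def Psi {Ω₂ : Type*} [MeasurableSpace Ω₂] (P₂ : Measure Ω₂) {d : ℕ}
    (b : unitInterval → Fin d → Bool) (U : unitInterval × unitInterval × Ω₂ → ℝ)
    (F : (Fin d → Bool) → (Fin d → Bool) → ℝ → ℝ) : ℝ :=
  ∫ x, F (b x.1) (b x.2.1) (U x) ∂((volume : Measure unitInterval).prod
    ((volume : Measure unitInterval).prod P₂))

def dec0 {d : ℕ} (z : RE (2 * d + 1)) : Fin d → Bool :=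
  fun j => decide (1/2 < z ⟨2 * j, by omega⟩)
def dec1 {d : ℕ} (z : RE (2 * d + 1)) : Fin d → Bool :=
  fun j => decide (1/2 < z ⟨2 * j + 1, by omega⟩)
def decW {d : ℕ} (z : RE (2 * d + 1)) : ℝ := z ⟨2 * d, by omega⟩

lemma meas_coord {n : ℕ} (i : Fin n) : Measurable fun z : RE n => z i :=
  (EuclideanSpace.proj (𝕜 := ℝ) i).continuous.measurable

lemma meas_decide {X : Type*} [MeasurableSpace X] (f : X → ℝ) (hf : Measurable f) :
    Measurable fun x => decide (1/2 < f x) :=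
  measurable_to_bool (by
    have : (fun x => decide (1/2 < f x)) ⁻¹' {true} = {x | 1/2 < f x} := by ext; simp
    rw [this]; exact measurableSet_lt measurable_const hf)

lemma meas_dec0 {d : ℕ} : Measurable (dec0 (d := d)) :=
  measurable_pi_lambda _ fun _ => meas_decide _ (meas_coord _)
lemma meas_dec1 {d : ℕ} : Measurable (dec1 (d := d)) :=
  measurable_pi_lambda _ fun _ => meas_decide _ (meas_coord _)
lemma meas_decW {d : ℕ} : Measurable (decW (d := d)) := meas_coord _

lemma meas_F {X : Type*} [MeasurableSpace X] {d : ℕ}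
    (F : (Fin d → Bool) → (Fin d → Bool) → ℝ → ℝ) (hF : ∀ a a', Measurable (F a a'))
    (p q : X → Fin d → Bool) (w : X → ℝ) (hp : Measurable p) (hq : Measurable q)
    (hw : Measurable w) : Measurable fun x => F (p x) (q x) (w x) := by
  have : Measurable fun y : ((Fin d → Bool) × (Fin d → Bool)) × ℝ => F y.1.1 y.1.2 y.2 :=
    measurable_from_prod_countable_right fun a => hF a.1 a.2
  exact this.comp ((hp.prodMk hq).prodMk hw)

lemma sVec_even {Ω₁ Ω₂ : Type*} {d : ℕ} (f : Fin d → Ω₁ → ℝ) (W : Ω₁ × Ω₁ × Ω₂ → ℝ)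
    (x : Ω₁ × Ω₁ × Ω₂) (j : Fin d) : sVec d f W x ⟨2 * j, by omega⟩ = f j x.1 := by
  have h : 2 * (j:ℕ) < 2 * d := by omega
  simp [sVec]

lemma sVec_odd {Ω₁ Ω₂ : Type*} {d : ℕ} (f : Fin d → Ω₁ → ℝ) (W : Ω₁ × Ω₁ × Ω₂ → ℝ)
    (x : Ω₁ × Ω₁ × Ω₂) (j : Fin d) : sVec d f W x ⟨2 * j + 1, by omega⟩ = f j x.2.1 := by
  have h : 2 * (j:ℕ) + 1 < 2 * d := by omega
  have h2 : (2 * (j:ℕ) + 1) / 2 = j := by omega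
  have h3 : (2 * (j:ℕ) + 1) % 2 = 1 := by omega
  simp [sVec, h, h2]

lemma sVec_last {Ω₁ Ω₂ : Type*} {d : ℕ} (f : Fin d → Ω₁ → ℝ) (W : Ω₁ × Ω₁ × Ω₂ → ℝ)
    (x : Ω₁ × Ω₁ × Ω₂) : sVec d f W x ⟨2 * d, by omega⟩ = W x := by
  simp [sVec]

lemma Psi_eq {Ω₂ : Type*} [MeasurableSpace Ω₂] (P₂ : Measure Ω₂) {d : ℕ}
    (f : Fin d → unitInterval → ℝ) (hf : ∀ i, Measurable (f i))
    (b : unitInterval → Fin d → Bool) (hb : ∀ x j, b x j = decide (1/2 < f j x))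
    (U : unitInterval × unitInterval × Ω₂ → ℝ) (hU : Measurable U)
    (F : (Fin d → Bool) → (Fin d → Bool) → ℝ → ℝ) (hF : ∀ a a', Measurable (F a a')) :
    Psi P₂ b U F = ∫ z, F (dec0 z) (dec1 z) (decW z) ∂(Smeasure volume P₂ f U) := by
  unfold Smeasure
  rw [integral_map (sVec_meas f hf U hU).aemeasurable
    (meas_F F hF _ _ _ meas_dec0 meas_dec1 meas_decW).aestronglyMeasurable]
  unfold Psi
  congr 1
  ext x
  have e0 : dec0 (sVec d f U x) = b x.1 := by ext j; simp only [dec0, sVec_even, hb]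
  have e1 : dec1 (sVec d f U x) = b x.2.1 := by ext j; simp only [dec1, sVec_odd, hb]
  have e2 : decW (sVec d f U x) = U x := by simp only [decW, sVec_last]
  rw [e0, e1, e2]

lemma bool_transfer {Ω₂ : Type*} [MeasurableSpace Ω₂] (P₂ : Measure Ω₂) [IsProbabilityMeasure P₂]
    {d : ℕ} (U V : unitInterval × unitInterval × Ω₂ → ℝ) (hU : Measurable U) (hV : Measurable V)
    (ρ : ℝ) (hρ : 0 < ρ) (hρ2 : ρ ≤ 1/2)
    (H : ∀ f : Fin d → unitInterval → ℝ, (∀ i, Measurable (f i)) →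
      (∀ i x, f i x ∈ Icc (-1 : ℝ) 1) → ∃ g : Fin d → unitInterval → ℝ, (∀ i, Measurable (g i)) ∧
      (∀ i x, g i x ∈ Icc (-1 : ℝ) 1) ∧
      levyProkhorovEDist (Smeasure volume P₂ f U) (Smeasure volume P₂ g V)
        < ENNReal.ofReal ρ) (b : unitInterval → Fin d → Bool) (hb : Measurable b) :
    ∃ b' : unitInterval → Fin d → Bool, Measurable b' ∧
      ∀ (F : (Fin d → Bool) → (Fin d → Bool) → ℝ → ℝ) (L M : ℝ), 0 ≤ L →
        (∀ a a', Measurable (F a a')) →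
        (∀ a a' w w', |F a a' w - F a a' w'| ≤ L * |w - w'|) → (∀ a a' w, |F a a' w| ≤ M) →
        |Psi P₂ b U F - Psi P₂ b' V F| ≤ (L + 2 * M) * ρ := by
  set f : Fin d → unitInterval → ℝ := fun j x => if b x j then 1 else 0 with hfdef
  have hf : ∀ i, Measurable (f i) := fun i => by
    have : Measurable fun t : Bool => (if t then (1:ℝ) else 0) := measurable_of_countable _
    exact this.comp ((measurable_pi_apply i).comp hb)
  have hf1 : ∀ i x, f i x ∈ Icc (-1 : ℝ) 1 := fun i x => by
    simp only [f]; split_ifs <;> norm_num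
  have hbf : ∀ x j, b x j = decide (1/2 < f j x) := fun x j => by
    by_cases h : b x j = true <;> simp [f, h] <;> norm_num
  obtain ⟨g, hg, -, hLP⟩ := H f hf hf1
  have hp1 := Smeasure_prob P₂ f hf U hU
  have hp2 := Smeasure_prob P₂ g hg V hV
  refine ⟨fun x j => decide (1/2 < g j x), measurable_pi_lambda _ fun j => meas_decide _ (hg j), ?_⟩
  have main : ∀ (F : (Fin d → Bool) → (Fin d → Bool) → ℝ → ℝ) (L M : ℝ), 0 ≤ L →
        (∀ a a', Measurable (F a a')) →
        (∀ a a' w w', |F a a' w - F a a' w'| ≤ L * |w - w'|) → (∀ a a' w, |F a a' w| ≤ M) →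
        Psi P₂ b U F ≤ Psi P₂ (fun x j => decide (1/2 < g j x)) V F + (L + 2 * M) * ρ := by
    intro F L M hL hF hFL hFM
    rw [Psi_eq P₂ f hf b hbf U hU F hF, Psi_eq P₂ g hg _ (fun _ _ => rfl) V hV F hF]
    set G : RE (2 * d + 1) → ℝ := fun z => F (dec0 z) (dec1 z) (decW z) with hG
    have hGm : Measurable G := meas_F F hF _ _ _ meas_dec0 meas_dec1 meas_decW
    have hGi : ∀ (μ : Measure (RE (2 * d + 1))) [IsProbabilityMeasure μ], Integrable G μ :=
      fun μ _ => Integrable.of_bound hGm.aestronglyMeasurable M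
        (Filter.Eventually.of_forall fun x => hFM _ _ _)
    set D : Set (RE (2 * d + 1)) := {z | ∀ i : Fin (2 * d + 1), (i:ℕ) < 2 * d → (z i = 0 ∨ z i = 1)} with hD
    have hDm : MeasurableSet D := by
      have : D = ⋂ i : Fin (2 * d + 1), ⋂ _ : (i:ℕ) < 2 * d, (fun z : RE (2 * d + 1) => z i) ⁻¹' {0, 1} := by
        ext z; rw [mem_iInter₂]; exact Iff.rfl
      rw [this]
      exact MeasurableSet.iInter fun i => MeasurableSet.iInter fun _ =>
        meas_coord i (Set.toFinite _).measurableSet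
    have hD0 : (Smeasure volume P₂ f U) Dᶜ = 0 := by
      unfold Smeasure
      rw [Measure.map_apply (sVec_meas f hf U hU) hDm.compl]
      have : sVec d f U ⁻¹' Dᶜ = ∅ := by
        rw [preimage_compl, compl_empty_iff, eq_univ_iff_forall]
        intro x i hi
        simp only [sVec, f]
        simp [hi]
        split_ifs <;> simp
      rw [this, measure_empty]
    have := lp_int _ _ ρ hρ hLP (fun z => G z + M) (hGm.add_const M) (2 * M)
      (fun z => by have := abs_le.1 (hFM (dec0 z) (dec1 z) (decW z)); simp only [G]; linarith)
      (fun z => by have := abs_le.1 (hFM (dec0 z) (dec1 z) (decW z)); simp only [G]; linarith)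
      D hDm hD0 (L * ρ) (by positivity) (by
        intro z hz y hzy
        rw [edist_lt_ofReal] at hzy
        have hc : ∀ i, |z i - y i| < ρ := fun i => by
          refine lt_of_le_of_lt ?_ hzy
          rw [dist_eq_norm]
          exact PiLp.norm_apply_le (z - y) i
        have hdec : ∀ i : Fin (2 * d + 1), (i:ℕ) < 2 * d → decide (1/2 < z i) = decide (1/2 < y i) := by
          intro i hi
          have h1 := abs_lt.1 (hc i)
          rcases hz i hi with h | h
          · rw [decide_eq_decide, h]; rw [h] at h1
            constructor <;> intro h' <;> linarith
          · rw [decide_eq_decide, h]; rw [h] at h1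
            constructor <;> intro h' <;> linarith
        have e0 : dec0 z = dec0 y := by ext j; exact (hdec ⟨2 * j, by omega⟩ (by show 2 * (j:ℕ) < 2 * d; omega))
        have e1 : dec1 z = dec1 y := by
          ext j; exact (hdec ⟨2 * j + 1, by omega⟩ (by show 2 * (j:ℕ) + 1 < 2 * d; omega))
        simp only [G, e0, e1]
        have h1 := (abs_le.1 (hFL (dec0 y) (dec1 y) (decW z) (decW y))).2
        have h2 : L * |decW z - decW y| ≤ L * ρ := mul_le_mul_of_nonneg_left (hc _).le hL
        linarith)
    rw [integral_add (hGi _) (integrable_const _), integral_add (hGi _) (integrable_const _)] at this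
    simp only [integral_const, probReal_univ, one_smul] at this
    linarith
  intro F L M hL hF hFL hFM
  have h1 := main F L M hL hF hFL hFM
  have h2 := main (fun a a' w => - F a a' w) L M hL (fun a a' => (hF a a').neg)
    (fun a a' w w' => by rw [← abs_neg]; convert hFL a a' w w' using 2; ring)
    (fun a a' w => by rw [abs_neg]; exact hFM a a' w)
  simp only [Psi, integral_neg] at h1 h2 ⊢
  rw [abs_le]; constructor <;> linarith


def eF {ι : Type} [Fintype ι] (h : ι → ℝ → ℝ) {d : ℕ}
    (c : ι → (Fin d → Bool) → (Fin d → Bool) → ℝ) (a a' : Fin d → Bool) (w : ℝ) : ℝ :=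
  ∑ i, (2 * h i w * c i a a' - (c i a a') ^ 2)

def EnSet {Ω₂ : Type*} [MeasurableSpace Ω₂] (P₂ : Measure Ω₂) {ι : Type} [Fintype ι]
    (h : ι → ℝ → ℝ) (d : ℕ) (U : unitInterval × unitInterval × Ω₂ → ℝ) : Set ℝ :=
  {t | ∃ b : unitInterval → Fin d → Bool, Measurable b ∧
    ∃ c : ι → (Fin d → Bool) → (Fin d → Bool) → ℝ, (∀ i a a', |c i a a'| ≤ d) ∧
      t = Psi P₂ b U (eF h c)}

def En {Ω₂ : Type*} [MeasurableSpace Ω₂] (P₂ : Measure Ω₂) {ι : Type} [Fintype ι]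
    (h : ι → ℝ → ℝ) (d : ℕ) (U : unitInterval × unitInterval × Ω₂ → ℝ) : ℝ :=
  sSup (EnSet P₂ h d U)

lemma eF_meas {ι : Type} [Fintype ι] (h : ι → ℝ → ℝ)
    (hm : ∀ i, Measurable (h i))
    (d : ℕ) (c : ι → (Fin d → Bool) → (Fin d → Bool) → ℝ) (a a') : Measurable (eF h c a a') := by
  unfold eF
  exact Finset.measurable_sum _ fun i _ => (((hm i).const_mul 2).mul_const _).sub_const _

lemma eF_le {ι : Type} [Fintype ι] (h : ι → ℝ → ℝ)
    (h0 : ∀ i w, 0 ≤ h i w) (h1 : ∀ i w, h i w ≤ 1)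
    (d : ℕ) (c : ι → (Fin d → Bool) → (Fin d → Bool) → ℝ) (a a' w) :
    eF h c a a' w ≤ Fintype.card ι := by
  unfold eF
  calc _ ≤ ∑ i : ι, (1:ℝ) := Finset.sum_le_sum fun i _ => by
        nlinarith [sq_nonneg (h i w - c i a a'), h0 i w, h1 i w]
    _ = _ := by simp

lemma eF_abs {ι : Type} [Fintype ι] (h : ι → ℝ → ℝ)
    (h0 : ∀ i w, 0 ≤ h i w) (h1 : ∀ i w, h i w ≤ 1)
    (d : ℕ) (c : ι → (Fin d → Bool) → (Fin d → Bool) → ℝ) (hc : ∀ i a a', |c i a a'| ≤ d)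
    (a a' w) : |eF h c a a' w| ≤ Fintype.card ι * (2 * d + (d:ℝ)^2) := by
  unfold eF
  refine (Finset.abs_sum_le_sum_abs _ _).trans ?_
  calc _ ≤ ∑ i : ι, (2 * d + (d:ℝ)^2) := Finset.sum_le_sum fun i _ => by
        have e1 : |2 * h i w * c i a a'| ≤ 2 * d := by
          rw [abs_mul, abs_of_nonneg (by have := h0 i w; positivity)]
          have := h1 i w
          have := h0 i w
          calc 2 * h i w * |c i a a'| ≤ (2 * 1) * d := by gcongr; exact hc i a a'
            _ = _ := by ring
        have e2 : |(c i a a')^2| ≤ (d:ℝ)^2 := by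
          rw [abs_pow]; gcongr; exact hc i a a'
        exact (abs_sub _ _).trans (add_le_add e1 e2)
    _ = _ := by simp; ring

lemma eF_lip {ι : Type} [Fintype ι] (h : ι → ℝ → ℝ)
    (L : ℝ)
    (hlip : ∀ i w w', |h i w - h i w'| ≤ L * |w - w'|)
    (d : ℕ) (c : ι → (Fin d → Bool) → (Fin d → Bool) → ℝ) (hc : ∀ i a a', |c i a a'| ≤ d)
    (a a' w w') : |eF h c a a' w - eF h c a a' w'| ≤ (Fintype.card ι * (2 * d * L)) * |w - w'| := by
  unfold eF
  rw [← Finset.sum_sub_distrib]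
  refine (Finset.abs_sum_le_sum_abs _ _).trans ?_
  calc _ ≤ ∑ i : ι, (2 * d * L) * |w - w'| := Finset.sum_le_sum fun i _ => by
        have : 2 * h i w * c i a a' - (c i a a')^2 - (2 * h i w' * c i a a' - (c i a a')^2)
          = 2 * (c i a a' * (h i w - h i w')) := by ring
        rw [this, abs_mul, abs_mul]
        have e := mul_le_mul (hc i a a') (hlip i w w') (abs_nonneg _) (by positivity)
        simp only [Nat.abs_ofNat]
        nlinarith
    _ = _ := by simp; ring

lemma eF_int {Ω₂ : Type*} [MeasurableSpace Ω₂] (P₂ : Measure Ω₂) [IsProbabilityMeasure P₂]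
    {ι : Type} [Fintype ι] (h : ι → ℝ → ℝ)
    (h0 : ∀ i w, 0 ≤ h i w) (h1 : ∀ i w, h i w ≤ 1)
    (hm : ∀ i, Measurable (h i))
    (d : ℕ)
    (U : unitInterval × unitInterval × Ω₂ → ℝ)
    (hU : Measurable U) (b : unitInterval → Fin d → Bool) (hb : Measurable b)
    (c : ι → (Fin d → Bool) → (Fin d → Bool) → ℝ) (hc : ∀ i a a', |c i a a'| ≤ d) :
    Integrable (fun x => eF h c (b x.1) (b x.2.1) (U x)) ((volume : Measure unitInterval).prod
    ((volume : Measure unitInterval).prod P₂)) :=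
  Integrable.of_bound (meas_F _ (eF_meas h hm d c) _ _ _ (hb.comp measurable_fst)
    (hb.comp (measurable_fst.comp measurable_snd)) hU).aestronglyMeasurable _
    (Filter.Eventually.of_forall fun _ => eF_abs h h0 h1 d c hc _ _ _)

lemma EnSet_le {Ω₂ : Type*} [MeasurableSpace Ω₂] (P₂ : Measure Ω₂) [IsProbabilityMeasure P₂]
    {ι : Type} [Fintype ι] (h : ι → ℝ → ℝ)
    (h0 : ∀ i w, 0 ≤ h i w) (h1 : ∀ i w, h i w ≤ 1)
    (hm : ∀ i, Measurable (h i))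
    (d : ℕ)
    (U : unitInterval × unitInterval × Ω₂ → ℝ)
    (hU : Measurable U) : ∀ t ∈ EnSet P₂ h d U, t ≤ Fintype.card ι := by
  rintro t ⟨b, hb, c, hc, rfl⟩
  unfold Psi
  calc _ ≤ ∫ x, (Fintype.card ι : ℝ) ∂((volume : Measure unitInterval).prod
          ((volume : Measure unitInterval).prod P₂)) :=
        integral_mono (eF_int P₂ h h0 h1 hm d U hU b hb c hc) (integrable_const _)
          fun x => eF_le h h0 h1 d c _ _ _
    _ = _ := by simp

lemma EnSet_zero {Ω₂ : Type*} [MeasurableSpace Ω₂] (P₂ : Measure Ω₂) [IsProbabilityMeasure P₂]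
    {ι : Type} [Fintype ι] (h : ι → ℝ → ℝ)
    (d : ℕ)
    (U : unitInterval × unitInterval × Ω₂ → ℝ) : (0:ℝ) ∈ EnSet P₂ h d U :=
  ⟨fun _ _ => true, measurable_const, fun _ _ _ => 0, by simp, by simp [Psi, eF]⟩

lemma En_bdd {Ω₂ : Type*} [MeasurableSpace Ω₂] (P₂ : Measure Ω₂) [IsProbabilityMeasure P₂]
    {ι : Type} [Fintype ι] (h : ι → ℝ → ℝ)
    (h0 : ∀ i w, 0 ≤ h i w) (h1 : ∀ i w, h i w ≤ 1)
    (hm : ∀ i, Measurable (h i))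
    (d : ℕ)
    (U : unitInterval × unitInterval × Ω₂ → ℝ)
    (hU : Measurable U) : BddAbove (EnSet P₂ h d U) := ⟨_, EnSet_le P₂ h h0 h1 hm d U hU⟩

lemma En_nonneg {Ω₂ : Type*} [MeasurableSpace Ω₂] (P₂ : Measure Ω₂) [IsProbabilityMeasure P₂]
    {ι : Type} [Fintype ι] (h : ι → ℝ → ℝ)
    (h0 : ∀ i w, 0 ≤ h i w) (h1 : ∀ i w, h i w ≤ 1)
    (hm : ∀ i, Measurable (h i))
    (d : ℕ)
    (U : unitInterval × unitInterval × Ω₂ → ℝ)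
    (hU : Measurable U) : 0 ≤ En P₂ h d U := le_csSup (En_bdd P₂ h h0 h1 hm d U hU) (EnSet_zero P₂ h d U)

lemma En_le {Ω₂ : Type*} [MeasurableSpace Ω₂] (P₂ : Measure Ω₂) [IsProbabilityMeasure P₂]
    {ι : Type} [Fintype ι] (h : ι → ℝ → ℝ)
    (h0 : ∀ i w, 0 ≤ h i w) (h1 : ∀ i w, h i w ≤ 1)
    (hm : ∀ i, Measurable (h i))
    (d : ℕ)
    (U : unitInterval × unitInterval × Ω₂ → ℝ)
    (hU : Measurable U) : En P₂ h d U ≤ Fintype.card ι :=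
  csSup_le ⟨_, EnSet_zero P₂ h d U⟩ (EnSet_le P₂ h h0 h1 hm d U hU)

lemma En_transfer {Ω₂ : Type*} [MeasurableSpace Ω₂] (P₂ : Measure Ω₂) [IsProbabilityMeasure P₂]
    {ι : Type} [Fintype ι] (h : ι → ℝ → ℝ)
    (L : ℝ)
    (hL : 0 ≤ L)
    (h0 : ∀ i w, 0 ≤ h i w) (h1 : ∀ i w, h i w ≤ 1)
    (hm : ∀ i, Measurable (h i))
    (hlip : ∀ i w w', |h i w - h i w'| ≤ L * |w - w'|)
    (d : ℕ)
    (U : unitInterval × unitInterval × Ω₂ → ℝ)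
    (hU : Measurable U) (V : unitInterval × unitInterval × Ω₂ → ℝ) (hV : Measurable V)
    (ρ : ℝ) (hρ : 0 < ρ) (hρ2 : ρ ≤ 1/2)
    (H : ∀ f : Fin d → unitInterval → ℝ, (∀ i, Measurable (f i)) →
      (∀ i x, f i x ∈ Icc (-1 : ℝ) 1) → ∃ g : Fin d → unitInterval → ℝ, (∀ i, Measurable (g i)) ∧
      (∀ i x, g i x ∈ Icc (-1 : ℝ) 1) ∧
      levyProkhorovEDist (Smeasure volume P₂ f U) (Smeasure volume P₂ g V)
        < ENNReal.ofReal ρ) :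
    En P₂ h d U ≤ En P₂ h d V + (Fintype.card ι * (2 * d * L) +
      2 * (Fintype.card ι * (2 * d + (d:ℝ)^2))) * ρ := by
  refine csSup_le ⟨_, EnSet_zero P₂ h d U⟩ ?_
  rintro t ⟨b, hb, c, hc, rfl⟩
  obtain ⟨b', hb', h'⟩ := bool_transfer P₂ U V hU hV ρ hρ hρ2 H b hb
  have := (abs_le.1 (h' (eF h c) _ _ (by positivity) (eF_meas h hm d c)
    (eF_lip h L hlip d c hc) (eF_abs h h0 h1 d c hc))).2
  have h2 : Psi P₂ b' V (eF h c) ≤ En P₂ h d V :=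
    le_csSup (En_bdd P₂ h h0 h1 hm d V hV) ⟨b', hb', c, hc, rfl⟩
  linarith

lemma cut_close {Ω₂ : Type*} [MeasurableSpace Ω₂] (P₂ : Measure Ω₂) [IsProbabilityMeasure P₂]
    {ι : Type} [Fintype ι] (h : ι → ℝ → ℝ)
    (h0 : ∀ i w, 0 ≤ h i w) (h1 : ∀ i w, h i w ≤ 1)
    (hm : ∀ i, Measurable (h i))
    (d : ℕ)
    (U : unitInterval × unitInterval × Ω₂ → ℝ)
    (hU : Measurable U) (b : unitInterval → Fin d → Bool) (hb : Measurable b)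
    (c : ι → (Fin d → Bool) → (Fin d → Bool) → ℝ) (hc : ∀ i a a', |c i a a'| ≤ d)
    (η : ℝ) (hη : 0 < η) (hη1 : η ≤ 1) (hopt : En P₂ h (d+2) U ≤ Psi P₂ b U (eF h c) + η ^ 2)
    (i : ι) (S T : Set unitInterval) (hS : MeasurableSet S) (hT : MeasurableSet T) :
    |∫ x, (S ×ˢ T ×ˢ (univ : Set Ω₂)).indicator
      (fun x => h i (U x) - c i (b x.1) (b x.2.1)) x ∂((volume : Measure unitInterval).prod
        ((volume : Measure unitInterval).prod P₂))| ≤ η := by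
  classical
  set Q := (volume : Measure unitInterval).prod ((volume : Measure unitInterval).prod P₂) with hQ
  set R := (S ×ˢ T ×ˢ (univ : Set Ω₂)) with hR
  have hRm : MeasurableSet R := hS.prod (hT.prod MeasurableSet.univ)
  set g : unitInterval × unitInterval × Ω₂ → ℝ := fun x => h i (U x) - c i (b x.1) (b x.2.1) with hg
  have hgm : Measurable g := ((hm i).comp hU).sub
    (meas_F (fun a a' _ => c i a a') (fun _ _ => measurable_const) _ _ U (hb.comp measurable_fst)
      (hb.comp (measurable_fst.comp measurable_snd)) hU)
  have hgi : Integrable g Q := Integrable.of_bound hgm.aestronglyMeasurable (1 + d)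
    (Filter.Eventually.of_forall fun x => by
      refine (abs_sub _ _).trans (add_le_add ?_ (hc _ _ _))
      rw [abs_of_nonneg (h0 _ _)]; exact h1 _ _)
  have key : ∀ t : ℝ, |t| = η → 2 * (t * ∫ x, R.indicator g x ∂Q) ≤ 2 * η ^ 2 := by
    intro t ht
    set b' : unitInterval → Fin (d+2) → Bool := fun x =>
      Matrix.vecCons (decide (x ∈ S)) (Matrix.vecCons (decide (x ∈ T)) (b x)) with hb'
    have hb'm : Measurable b' := by
      refine measurable_pi_lambda _ fun j => ?_
      refine Fin.cases ?_ (fun j => Fin.cases ?_ (fun j => ?_) j) j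
      · simp only [b', Matrix.cons_val_zero]
        exact measurable_to_bool (by convert hS using 1; ext; simp)
      · simp only [b', Matrix.cons_val_succ, Matrix.cons_val_zero]
        exact measurable_to_bool (by convert hT using 1; ext; simp)
      · simp only [b', Matrix.cons_val_succ]
        exact (measurable_pi_apply j).comp hb
    set c' : ι → (Fin (d+2) → Bool) → (Fin (d+2) → Bool) → ℝ := fun j a a' =>
      c j (fun l => a l.succ.succ) (fun l => a' l.succ.succ) +
        if j = i then (if a 0 = true ∧ a' 1 = true then t else 0) else 0 with hc'
    have hc'b : ∀ j a a', |c' j a a'| ≤ (d+2 : ℕ) := by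
      intro j a a'
      refine (abs_add_le _ _).trans ?_
      push_cast
      refine add_le_add (hc _ _ _) ?_
      split_ifs
      · rw [ht]; linarith
      · rw [abs_zero]; norm_num
      · rw [abs_zero]; norm_num
    have hP : Psi P₂ b' U (eF h c') ≤ En P₂ h (d+2) U :=
      le_csSup (En_bdd P₂ h h0 h1 hm (d+2) U hU) ⟨b', hb'm, c', hc'b, rfl⟩
    have hpt : ∀ x, eF h c' (b' x.1) (b' x.2.1) (U x) =
        eF h c (b x.1) (b x.2.1) (U x) + (2 * t * R.indicator g x - R.indicator (fun _ => t^2) x) := by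
      intro x
      simp only [eF, c', b']
      rw [← sub_eq_iff_eq_add', ← Finset.sum_sub_distrib, Finset.sum_eq_single i]
      · by_cases hx : x ∈ R
        · have hx1 : x.1 ∈ S := hx.1
          have hx2 : x.2.1 ∈ T := hx.2.1
          simp [hx, hx1, hx2, g]; ring
        · have : ¬ (x.1 ∈ S ∧ x.2.1 ∈ T) := fun hh => hx ⟨hh.1, hh.2, trivial⟩
          simp [hx, this]
      · intro j _ hj
        simp [hj]
      · simp
    have hPsi : Psi P₂ b' U (eF h c') = Psi P₂ b U (eF h c) +
        (2 * t * ∫ x, R.indicator g x ∂Q - ∫ x, R.indicator (fun _ => t^2) x ∂Q) := by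
      unfold Psi
      simp_rw [hpt]
      have i1 : Integrable (fun x => 2 * t * R.indicator g x) Q := (hgi.indicator hRm).const_mul _
      have i2 : Integrable (fun x => R.indicator (fun _ => t^2) x) Q :=
        (integrable_const _).indicator hRm
      have i12 : Integrable (fun x => 2 * t * R.indicator g x - R.indicator (fun _ => t^2) x) Q :=
        i1.sub i2
      rw [integral_add (eF_int P₂ h h0 h1 hm d U hU b hb c hc) i12, integral_sub i1 i2,
        integral_const_mul]
    have hsq : ∫ x, R.indicator (fun _ => t^2) x ∂Q ≤ η^2 := by
      rw [← ht, sq_abs]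
      calc _ ≤ ∫ x, t^2 ∂Q := integral_mono ((integrable_const _).indicator hRm) (integrable_const _)
            fun x => indicator_le_self' (fun _ _ => sq_nonneg t) x
        _ = _ := by simp [hQ]
    nlinarith
  have k1 := key η (abs_of_pos hη)
  have k2 := key (-η) (by rw [abs_neg, abs_of_pos hη])
  rw [abs_le]
  constructor
  · by_contra hh; push Not at hh; nlinarith
  · by_contra hh; push Not at hh; nlinarith



lemma exists_perm {N : ℕ} {A : Type*} [Fintype A] [DecidableEq A] (p q : Fin N → A) :
    ∃ σ : Equiv.Perm (Fin N), ((Finset.univ.filter fun i => p i ≠ q (σ i)).card : ℝ) ≤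
      ∑ a, |((Finset.univ.filter fun i => p i = a).card : ℝ)
        - ((Finset.univ.filter fun i => q i = a).card : ℝ)| := by
  obtain ⟨σ, -, hσ⟩ := Finset.exists_min_image (Finset.univ : Finset (Equiv.Perm (Fin N)))
    (fun σ => (Finset.univ.filter fun i => p i ≠ q (σ i)).card) ⟨1, Finset.mem_univ _⟩
  refine ⟨σ, ?_⟩
  have hsplit : (Finset.univ.filter fun i => p i ≠ q (σ i)).card =
      ∑ a, (Finset.univ.filter fun i => p i = a ∧ q (σ i) ≠ a).card := by
    rw [Finset.card_eq_sum_card_fiberwise (f := p) (t := Finset.univ) (fun _ _ => Finset.mem_coe.2 (Finset.mem_univ _))]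
    refine Finset.sum_congr rfl fun a _ => ?_
    congr 1
    ext i
    simp only [Finset.mem_filter, Finset.mem_univ, true_and]
    constructor
    · rintro ⟨h1, h2⟩; exact ⟨h2, fun h => h1 (h2.trans h.symm)⟩
    · rintro ⟨h1, h2⟩; exact ⟨fun h => h2 (h.symm.trans h1), h1⟩
  rw [hsplit]
  push_cast
  refine Finset.sum_le_sum fun a _ => ?_
  have hq : (Finset.univ.filter fun i => q i = a).card = (Finset.univ.filter fun i => q (σ i) = a).card := by
    refine (Finset.card_bij (fun i _ => σ i) ?_ ?_ ?_).symm
    · intro i hi; simpa using hi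
    · intro i _ j _ h; exact σ.injective h
    · intro j hj; exact ⟨σ.symm j, by simpa using hj, by simp⟩
  have e1 : (Finset.univ.filter fun i => p i = a).card =
      (Finset.univ.filter fun i => p i = a ∧ q (σ i) = a).card +
      (Finset.univ.filter fun i => p i = a ∧ q (σ i) ≠ a).card := by
    rw [← Finset.card_filter_add_card_filter_not (s := Finset.univ.filter fun i => p i = a) (fun i => q (σ i) = a),
      Finset.filter_filter, Finset.filter_filter]
  have e2 : (Finset.univ.filter fun i => q (σ i) = a).card =
      (Finset.univ.filter fun i => p i = a ∧ q (σ i) = a).card +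
      (Finset.univ.filter fun i => p i ≠ a ∧ q (σ i) = a).card := by
    rw [← Finset.card_filter_add_card_filter_not (s := Finset.univ.filter fun i => q (σ i) = a) (fun i => p i = a),
      Finset.filter_filter, Finset.filter_filter]
    simp only [and_comm]
  rw [hq, e1, e2]
  by_cases h1 : (Finset.univ.filter fun i => p i = a ∧ q (σ i) ≠ a) = ∅
  · rw [h1]; simp
  by_cases h2 : (Finset.univ.filter fun i => p i ≠ a ∧ q (σ i) = a) = ∅
  · rw [h2]; simp
  exfalso
  obtain ⟨i, hi⟩ := Finset.nonempty_iff_ne_empty.2 h1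
  obtain ⟨j, hj⟩ := Finset.nonempty_iff_ne_empty.2 h2
  simp only [Finset.mem_filter, Finset.mem_univ, true_and] at hi hj
  have hij : i ≠ j := by rintro rfl; exact hj.1 hi.1
  have := hσ (σ * Equiv.swap i j) (Finset.mem_univ _)
  refine absurd this (not_le.2 (Finset.card_lt_card ?_))
  rw [Finset.ssubset_iff_of_subset]
  · refine ⟨i, ?_, ?_⟩
    · simp only [Finset.mem_filter, Finset.mem_univ, true_and]
      rw [hi.1]; exact fun h => hi.2 h.symm
    · rw [Finset.mem_filter]
      simp [hi.1, hj.2]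
  · intro l hl
    have hl := (Finset.mem_filter.1 hl).2
    rw [Equiv.Perm.mul_apply] at hl
    simp only [Finset.mem_filter, Finset.mem_univ, true_and]
    by_cases hli : l = i
    · subst hli; rw [hi.1]; exact fun h => hi.2 h.symm
    by_cases hlj : l = j
    · subst hlj; rw [hj.2]; exact hj.1
    · rwa [Equiv.swap_apply_of_ne_of_ne hli hlj] at hl

def cell (N : ℕ) (hN : 0 < N) (x : unitInterval) : Fin N :=
  ⟨min ⌊(N:ℝ) * x⌋₊ (N - 1), by omega⟩

lemma cell_meas (N : ℕ) (hN : 0 < N) : Measurable (cell N hN) := by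
  have h1 : Measurable fun x : unitInterval => ⌊(N:ℝ) * x⌋₊ :=
    Nat.measurable_floor.comp (measurable_subtype_coe.const_mul _)
  have h2 : Measurable fun n : ℕ => (⟨min n (N - 1), by omega⟩ : Fin N) := measurable_of_countable _
  exact h2.comp h1

lemma cell_bounds (N : ℕ) (hN : 0 < N) (x : unitInterval) :
    ((cell N hN x : ℕ) : ℝ) / N ≤ x ∧ (x:ℝ) ≤ ((cell N hN x : ℕ) + 1) / N ∧
    ((x:ℝ) < 1 → (x:ℝ) < ((cell N hN x : ℕ) + 1) / N) := by
  have hN' : (0:ℝ) < N := by exact_mod_cast hN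
  have hx0 := x.2.1
  have hx1 := x.2.2
  have hfl : (⌊(N:ℝ) * x⌋₊ : ℝ) ≤ N * x := Nat.floor_le (by positivity)
  have hfl2 : (N:ℝ) * x < ⌊(N:ℝ) * x⌋₊ + 1 := Nat.lt_floor_add_one _
  have hlt : (x:ℝ) < 1 → (x:ℝ) < ((cell N hN x : ℕ) + 1) / N := by
    intro hx
    have : ⌊(N:ℝ) * x⌋₊ < N := by
      rw [Nat.floor_lt (by positivity)]; nlinarith
    have hc : (cell N hN x : ℕ) = ⌊(N:ℝ) * x⌋₊ := by simp only [cell]; omega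
    rw [hc, lt_div_iff₀ hN']; linarith
  refine ⟨?_, ?_, hlt⟩
  · rw [div_le_iff₀ hN']
    have : (cell N hN x : ℕ) ≤ ⌊(N:ℝ) * x⌋₊ := min_le_left _ _
    have : ((cell N hN x : ℕ) : ℝ) ≤ ⌊(N:ℝ) * x⌋₊ := by exact_mod_cast this
    linarith
  · rcases hx1.lt_or_eq with h | h
    · exact (hlt h).le
    · have : (cell N hN x : ℕ) = N - 1 := by simp [cell, h]
      rw [this, h, Nat.cast_sub hN]; simp [hN'.ne']

lemma cell_eq (N : ℕ) (hN : 0 < N) (x : unitInterval) (i : Fin N) (h1 : ((i:ℕ):ℝ) / N ≤ x)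
    (h2 : (x:ℝ) < ((i:ℕ) + 1) / N) : cell N hN x = i := by
  have hN' : (0:ℝ) < N := by exact_mod_cast hN
  rw [div_le_iff₀ hN'] at h1
  rw [lt_div_iff₀ hN'] at h2
  have : ⌊(N:ℝ) * x⌋₊ = i := by
    rw [Nat.floor_eq_iff (by have := x.2.1; positivity)]; constructor <;> linarith
  ext
  simp only [cell, this]
  omega

lemma cell_vol (N : ℕ) (hN : 0 < N) (i : Fin N) :
    (volume : Measure unitInterval).real (cell N hN ⁻¹' {i}) = 1 / N := by
  have hN' : (0:ℝ) < N := by exact_mod_cast hN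
  have hi : ((i:ℕ):ℝ) + 1 ≤ N := by exact_mod_cast i.2
  have m0 : ((i:ℕ):ℝ) / N ∈ unitInterval := ⟨by positivity, by rw [div_le_one hN']; linarith⟩
  have m1 : (((i:ℕ):ℝ) + 1) / N ∈ unitInterval := ⟨by positivity, by rw [div_le_one hN']; linarith⟩
  have hv : (volume : Measure unitInterval) (cell N hN ⁻¹' {i}) = ENNReal.ofReal (1 / N) := by
    apply le_antisymm
    · calc _ ≤ volume (Icc (⟨_, m0⟩ : unitInterval) ⟨_, m1⟩) := by
            refine measure_mono fun x hx => ?_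
            have hx : cell N hN x = i := hx
            have := cell_bounds N hN x
            rw [hx] at this
            exact ⟨this.1, this.2.1⟩
        _ = _ := by rw [unitInterval.volume_Icc]; congr 1; simp; ring
    · calc _ = volume (Ico (⟨_, m0⟩ : unitInterval) ⟨_, m1⟩) := by
            rw [unitInterval.volume_Ico]; congr 1; simp; ring
        _ ≤ _ := measure_mono fun x hx => cell_eq N hN x i hx.1 hx.2
  rw [Measure.real, hv, ENNReal.toReal_ofReal (by positivity)]

lemma cell_vol_set (N : ℕ) (hN : 0 < N) (s : Finset (Fin N)) :
    (volume : Measure unitInterval).real (cell N hN ⁻¹' s) = s.card / N := by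
  rw [← sum_measureReal_preimage_singleton s (fun i _ => cell_meas N hN (measurableSet_singleton i))]
  simp [cell_vol, div_eq_mul_inv]


lemma shift_bounds (N : ℕ) (hN : 0 < N) (σ : Equiv.Perm (Fin N)) (x : unitInterval) (hx : (x:ℝ) < 1) :
    ((σ (cell N hN x) : ℕ) : ℝ) / N ≤ (x:ℝ) + (((σ (cell N hN x) : ℕ) : ℝ) - (cell N hN x : ℕ)) / N ∧
    (x:ℝ) + (((σ (cell N hN x) : ℕ) : ℝ) - (cell N hN x : ℕ)) / N <
      (((σ (cell N hN x) : ℕ) : ℝ) + 1) / N := by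
  have hb := cell_bounds N hN x
  have h2 := hb.2.2 hx
  have h1 := hb.1
  rw [add_div] at h2 ⊢
  rw [sub_div]
  constructor <;> linarith

lemma shift_mem (N : ℕ) (hN : 0 < N) (σ : Equiv.Perm (Fin N)) (x : unitInterval) :
    (if (x:ℝ) < 1 then (x:ℝ) + (((σ (cell N hN x) : ℕ) : ℝ) - (cell N hN x : ℕ)) / N else x) ∈ unitInterval := by
  have hN' : (0:ℝ) < N := by exact_mod_cast hN
  split_ifs with hx
  · have := shift_bounds N hN σ x hx
    have hi : ((σ (cell N hN x) : ℕ):ℝ) + 1 ≤ N := by exact_mod_cast (σ (cell N hN x)).2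
    constructor
    · refine le_trans ?_ this.1; positivity
    · refine this.2.le.trans ?_
      rw [div_le_one hN']; exact hi
  · exact x.2

def shift (N : ℕ) (hN : 0 < N) (σ : Equiv.Perm (Fin N)) (x : unitInterval) : unitInterval :=
  ⟨_, shift_mem N hN σ x⟩

lemma shift_coe (N : ℕ) (hN : 0 < N) (σ : Equiv.Perm (Fin N)) (x : unitInterval) (hx : (x:ℝ) < 1) :
    ((shift N hN σ x : unitInterval) : ℝ) =
      (x:ℝ) + (((σ (cell N hN x) : ℕ) : ℝ) - (cell N hN x : ℕ)) / N := by
  simp only [shift, hx, if_true]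

lemma shift_one (N : ℕ) (hN : 0 < N) (σ : Equiv.Perm (Fin N)) (x : unitInterval) (hx : ¬ (x:ℝ) < 1) :
    shift N hN σ x = x := by
  ext
  simp only [shift, hx, if_false]

lemma shift_cell (N : ℕ) (hN : 0 < N) (σ : Equiv.Perm (Fin N)) (x : unitInterval) (hx : (x:ℝ) < 1) :
    cell N hN (shift N hN σ x) = σ (cell N hN x) := by
  have := shift_bounds N hN σ x hx
  rw [← shift_coe N hN σ x hx] at this
  exact cell_eq N hN _ _ this.1 this.2

lemma shift_lt (N : ℕ) (hN : 0 < N) (σ : Equiv.Perm (Fin N)) (x : unitInterval) (hx : (x:ℝ) < 1) :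
    ((shift N hN σ x : unitInterval) : ℝ) < 1 := by
  have hN' : (0:ℝ) < N := by exact_mod_cast hN
  have := shift_bounds N hN σ x hx
  rw [← shift_coe N hN σ x hx] at this
  have hi : ((σ (cell N hN x) : ℕ):ℝ) + 1 ≤ N := by exact_mod_cast (σ (cell N hN x)).2
  refine this.2.trans_le ?_
  rw [div_le_one hN']; exact hi

lemma shift_shift (N : ℕ) (hN : 0 < N) (σ τ : Equiv.Perm (Fin N)) (h : ∀ i, τ (σ i) = i)
    (x : unitInterval) : shift N hN τ (shift N hN σ x) = x := by
  by_cases hx : (x:ℝ) < 1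
  · ext
    rw [shift_coe N hN τ _ (shift_lt N hN σ x hx), shift_cell N hN σ x hx, h, shift_coe N hN σ x hx]
    ring
  · rw [shift_one N hN σ x hx, shift_one N hN τ x hx]

lemma shift_meas (N : ℕ) (hN : 0 < N) (σ : Equiv.Perm (Fin N)) : Measurable (shift N hN σ) := by
  refine Measurable.subtype_mk (Measurable.ite (measurableSet_lt measurable_subtype_coe measurable_const) ?_
    measurable_subtype_coe)
  refine measurable_subtype_coe.add ?_
  have : Measurable fun i : Fin N => (((σ i : ℕ) : ℝ) - (i : ℕ)) / N := measurable_of_countable _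
  exact this.comp (cell_meas N hN)

lemma vol_eq_sum_cell (N : ℕ) (hN : 0 < N) (B : Set unitInterval) (hB : MeasurableSet B) :
    volume B = ∑ i : Fin N, volume (B ∩ cell N hN ⁻¹' {i}) := by
  have h := measure_iUnion (μ := (volume : Measure unitInterval)) (f := fun i => B ∩ cell N hN ⁻¹' {i})
    (fun i j hij => by
      refine Set.disjoint_left.2 fun x hx hx' => hij ?_
      exact hx.2.symm.trans hx'.2)
    (fun i => hB.inter (cell_meas N hN (measurableSet_singleton i)))
  rw [tsum_fintype] at h
  rw [← h]
  congr 1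
  ext x; simp

lemma shift_vol_le (N : ℕ) (hN : 0 < N) (σ : Equiv.Perm (Fin N)) (B : Set unitInterval)
    (hB : MeasurableSet B) : volume (shift N hN σ ⁻¹' B) ≤ volume B := by
  rw [vol_eq_sum_cell N hN _ (shift_meas N hN σ hB), vol_eq_sum_cell N hN B hB,
    ← Equiv.sum_comp σ (fun i => volume (B ∩ cell N hN ⁻¹' {i}))]
  refine Finset.sum_le_sum fun i _ => ?_
  have hsub : shift N hN σ ⁻¹' B ∩ cell N hN ⁻¹' {i} ⊆
      {1} ∪ (shift N hN σ ⁻¹' B ∩ cell N hN ⁻¹' {i} ∩ {x | (x:ℝ) < 1}) := by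
    intro x hx
    by_cases hx1 : (x:ℝ) < 1
    · exact Or.inr ⟨hx, hx1⟩
    · left
      ext
      exact le_antisymm x.2.2 (not_lt.1 hx1)
  refine (measure_mono hsub).trans ((measure_union_le _ _).trans ?_)
  rw [measure_singleton, zero_add, unitInterval.volume_apply, unitInterval.volume_apply]
  rw [← measure_preimage_add_right volume ((((σ i : ℕ) : ℝ) - (i : ℕ)) / N)
    (Subtype.val '' (B ∩ cell N hN ⁻¹' {σ i}))]
  refine measure_mono ?_
  rintro _ ⟨x, ⟨⟨hxB, hxi⟩, hx1⟩, rfl⟩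
  have hxi : cell N hN x = i := hxi
  have hx1 : (x:ℝ) < 1 := hx1
  refine ⟨shift N hN σ x, ⟨hxB, ?_⟩, ?_⟩
  · show cell N hN _ = _
    rw [shift_cell N hN σ x hx1, hxi]
  · rw [shift_coe N hN σ x hx1, hxi]

lemma exists_shift (N : ℕ) (hN : 0 < N) (σ : Equiv.Perm (Fin N)) :
    ∃ φ : unitInterval ≃ᵐ unitInterval,
      MeasurePreserving φ (volume : Measure unitInterval) volume ∧
      ∀ x : unitInterval, (x:ℝ) < 1 → cell N hN (φ x) = σ (cell N hN x) := by
  refine ⟨⟨⟨shift N hN σ, shift N hN σ.symm, shift_shift N hN σ σ.symm (by simp),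
    shift_shift N hN σ.symm σ (by simp)⟩, shift_meas N hN σ, shift_meas N hN σ.symm⟩, ?_, ?_⟩
  · refine ⟨shift_meas N hN σ, ?_⟩
    ext B hB
    change (Measure.map (shift N hN σ) volume) B = _
    rw [Measure.map_apply (shift_meas N hN σ) hB]
    apply le_antisymm (shift_vol_le N hN σ B hB)
    calc volume B = volume (shift N hN σ.symm ⁻¹' (shift N hN σ ⁻¹' B)) := by
          congr 1; ext x; simp [shift_shift N hN σ.symm σ]
      _ ≤ _ := shift_vol_le N hN _ _ (shift_meas N hN σ hB)
  · exact fun x hx => shift_cell N hN σ x hx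

lemma exists_step {A : Type*} [Fintype A] [Nonempty A] [MeasurableSpace A] [MeasurableSingletonClass A]
    (b : unitInterval → A) (hb : Measurable b) (τ : ℝ) (hτ : 0 < τ) :
    ∃ N₀ : ℕ, ∀ (N : ℕ) (hN : 0 < N), N₀ ≤ N → ∃ p : Fin N → A,
      (volume : Measure unitInterval).real {x | b x ≠ p (cell N hN x)} ≤ τ := by
  classical
  have hA : (0:ℝ) < Fintype.card A := by exact_mod_cast Fintype.card_pos
  have hK : ∀ a : A, ∃ K ⊆ b ⁻¹' {a}, IsCompact K ∧
      volume (b ⁻¹' {a} \ K) < ENNReal.ofReal (τ / Fintype.card A) := fun a =>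
    (hb (measurableSet_singleton a)).exists_isCompact_sdiff_lt (measure_ne_top _ _)
      (by simpa using by positivity)
  choose K hKsub hKc hKv using hK
  have hsep : ∀ ac : A × A, ∃ r : ℝ, 0 < r ∧ (ac.1 ≠ ac.2 → ∀ x ∈ K ac.1, ∀ y ∈ K ac.2, r ≤ dist x y) := by
    rintro ⟨a, c⟩
    by_cases hac : a = c
    · exact ⟨1, one_pos, fun h => absurd hac h⟩
    have hd : Disjoint (K a) (K c) := Set.disjoint_left.2 fun x hx hx' =>
      hac ((hKsub a hx).symm.trans (hKsub c hx'))
    obtain ⟨r, hr, hrd⟩ := hd.exists_thickenings (hKc a) (hKc c).isClosed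
    refine ⟨r, hr, fun _ x hx y hy => ?_⟩
    by_contra hlt
    push Not at hlt
    exact Set.disjoint_left.1 hrd (Metric.self_subset_thickening hr _ hx)
      (Metric.mem_thickening_iff.2 ⟨y, hy, hlt⟩)
  choose r hr0 hr using hsep
  obtain ⟨ac0, -, hmin⟩ := Finset.exists_min_image (Finset.univ : Finset (A × A)) r
    ⟨Classical.arbitrary _, Finset.mem_univ _⟩
  obtain ⟨N₀, hN₀⟩ := exists_nat_gt (1 / r ac0)
  refine ⟨N₀, fun N hN hNN => ?_⟩
  have hN' : (0:ℝ) < N := by exact_mod_cast hN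
  have hNr : 1 / (N:ℝ) < r ac0 := by
    rw [div_lt_comm₀ hN' (hr0 _)]
    exact hN₀.trans_le (by exact_mod_cast hNN)
  have hcd : ∀ x y : unitInterval, cell N hN x = cell N hN y → dist x y ≤ 1 / N := by
    intro x y hxy
    have h1 := cell_bounds N hN x
    have h2 := cell_bounds N hN y
    rw [hxy] at h1
    rw [Subtype.dist_eq, Real.dist_eq, abs_le]
    rw [add_div] at h1 h2
    constructor <;> linarith [h1.1, h1.2.1, h2.1, h2.2.1]
  have hp : ∀ i : Fin N, ∃ a : A, ∀ x c, cell N hN x = i → x ∈ K c → c = a := by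
    intro i
    by_cases h : ∃ x c, cell N hN x = i ∧ x ∈ K c
    · obtain ⟨x, c, hxi, hxc⟩ := h
      refine ⟨c, fun y c' hyi hyc => ?_⟩
      by_contra hne
      have h1 := hr (c', c) hne y hyc x hxc
      have h2 := hcd y x (hyi.trans hxi.symm)
      have h3 := hmin (c', c) (Finset.mem_univ _)
      linarith
    · push Not at h
      exact ⟨Classical.arbitrary A, fun x c hx hxc => absurd hxc (h x c hx)⟩
  choose p hp using hp
  refine ⟨p, ?_⟩
  have hsub : {x | b x ≠ p (cell N hN x)} ⊆ ⋃ a, (b ⁻¹' {a} \ K a) := by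
    intro x hx
    refine mem_iUnion.2 ⟨b x, rfl, fun hxK => hx ?_⟩
    exact hp (cell N hN x) x (b x) rfl hxK
  have hv : volume {x | b x ≠ p (cell N hN x)} ≤ ENNReal.ofReal τ := by
    refine (measure_mono hsub).trans ((measure_iUnion_fintype_le _ _).trans ?_)
    calc _ ≤ ∑ a : A, ENNReal.ofReal (τ / Fintype.card A) := Finset.sum_le_sum fun a _ => (hKv a).le
      _ = _ := by
        rw [Finset.sum_const, Finset.card_univ, nsmul_eq_mul, ← ENNReal.ofReal_natCast,
          ← ENNReal.ofReal_mul (by positivity)]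
        congr 1; field_simp
  exact ENNReal.toReal_le_of_le_ofReal hτ.le hv

lemma exists_align {A : Type*} [Fintype A] [Nonempty A] [MeasurableSpace A] [MeasurableSingletonClass A]
    (b b' : unitInterval → A) (hb : Measurable b) (hb' : Measurable b') (δ : ℝ) (hδ : 0 < δ)
    (hbb : ∀ a, |(volume : Measure unitInterval).real (b ⁻¹' {a}) -
      (volume : Measure unitInterval).real (b' ⁻¹' {a})| ≤ δ) :
    ∃ φ : unitInterval ≃ᵐ unitInterval,
      MeasurePreserving φ (volume : Measure unitInterval) volume ∧
      (volume : Measure unitInterval).real {x | b x ≠ b' (φ x)} ≤ (2 + 3 * Fintype.card A) * δ := by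
  classical
  obtain ⟨N₁, h1⟩ := exists_step b hb δ hδ
  obtain ⟨N₂, h2⟩ := exists_step b' hb' δ hδ
  set N := N₁ + N₂ + 1 with hNdef
  have hN : 0 < N := by omega
  have hN' : (0:ℝ) < N := by exact_mod_cast hN
  obtain ⟨p, hp⟩ := h1 N hN (by omega)
  obtain ⟨q, hq⟩ := h2 N hN (by omega)
  obtain ⟨σ, hσ⟩ := exists_perm p q
  obtain ⟨φ, hφ, hφc⟩ := exists_shift N hN σ
  refine ⟨φ, hφ, ?_⟩
  have hcnt : ∀ (b : unitInterval → A) (p : Fin N → A),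
      (volume : Measure unitInterval).real {x | b x ≠ p (cell N hN x)} ≤ δ → ∀ a,
      |(volume : Measure unitInterval).real (b ⁻¹' {a}) -
        ((Finset.univ.filter fun i => p i = a).card : ℝ) / N| ≤ δ := by
    intro b p hbp a
    rw [← cell_vol_set N hN]
    have s1 : b ⁻¹' {a} ⊆ (cell N hN ⁻¹' (Finset.univ.filter fun i => p i = a : Finset (Fin N))) ∪
        {x | b x ≠ p (cell N hN x)} := by
      intro x hx
      have hx : b x = a := hx
      by_cases h : b x = p (cell N hN x)
      · left; simp [← h, hx]
      · right; exact h
    have s2 : (cell N hN ⁻¹' (Finset.univ.filter fun i => p i = a : Finset (Fin N))) ⊆ b ⁻¹' {a} ∪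
        {x | b x ≠ p (cell N hN x)} := by
      intro x hx
      have hx : p (cell N hN x) = a := by simpa using hx
      by_cases h : b x = p (cell N hN x)
      · left; exact h.trans hx
      · right; exact h
    have t1 := (measureReal_mono (μ := (volume : Measure unitInterval)) s1).trans (measureReal_union_le _ _)
    have t2 := (measureReal_mono (μ := (volume : Measure unitInterval)) s2).trans (measureReal_union_le _ _)
    rw [abs_le]; constructor <;> linarith
  have hmis : ((Finset.univ.filter fun i => p i ≠ q (σ i)).card : ℝ) / N ≤ Fintype.card A * (3 * δ) := by
    calc _ ≤ (∑ a, |((Finset.univ.filter fun i => p i = a).card : ℝ)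
        - ((Finset.univ.filter fun i => q i = a).card : ℝ)|) / N := by gcongr
      _ ≤ ∑ a : A, 3 * δ := by
        rw [Finset.sum_div]
        refine Finset.sum_le_sum fun a _ => ?_
        rw [← abs_of_pos hN', ← abs_div, sub_div]
        have e1 := abs_le.1 (hcnt b p hp a)
        have e2 := abs_le.1 (hcnt b' q hq a)
        have e3 := abs_le.1 (hbb a)
        rw [abs_le]; constructor <;> linarith
      _ = _ := by simp
  have hsub : {x | b x ≠ b' (φ x)} ⊆ {x | b x ≠ p (cell N hN x)} ∪
      (φ ⁻¹' {x | b' x ≠ q (cell N hN x)} ∪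
      (cell N hN ⁻¹' (Finset.univ.filter fun i => p i ≠ q (σ i) : Finset (Fin N)) ∪ {1})) := by
    intro x hx
    by_cases hx1 : (x:ℝ) < 1
    · by_cases e1 : b x = p (cell N hN x)
      · by_cases e2 : b' (φ x) = q (cell N hN (φ x))
        · right; right; left
          simp only [Finset.coe_filter, Finset.mem_univ, true_and, mem_preimage, mem_ofPred_eq]
          rw [← e1, ← hφc x hx1, ← e2]; exact hx
        · right; left; exact e2
      · left; exact e1
    · right; right; right
      ext
      exact le_antisymm x.2.2 (not_lt.1 hx1)
  have hpre : (volume : Measure unitInterval).real (φ ⁻¹' {x | b' x ≠ q (cell N hN x)}) =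
      (volume : Measure unitInterval).real {x | b' x ≠ q (cell N hN x)} := by
    unfold Measure.real
    rw [hφ.measure_preimage_equiv]
  have t := (measureReal_mono (μ := (volume : Measure unitInterval)) hsub).trans
    ((measureReal_union_le _ _).trans (add_le_add_right ((measureReal_union_le _ _).trans
      (add_le_add_right (measureReal_union_le _ _) _)) _))
  rw [hpre, cell_vol_set] at t
  have z : (volume : Measure unitInterval).real {1} = 0 := by simp [Measure.real]
  rw [z] at t
  linarith


lemma lp_half (h : ℝ → ℝ) (hm : Measurable h) (h0 : ∀ w, 0 ≤ h w) (h1 : ∀ w, h w ≤ 1)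
    (μ ν : Measure ℝ) [IsFiniteMeasure μ] [IsFiniteMeasure ν] (K τ η ε : ℝ) (B C : Set ℝ)
    (hB : MeasurableSet B) (hC : MeasurableSet C)
    (hBh : ∀ w ∈ B, |w| ≤ K → h w = 1) (hCh : ∀ w, w ∉ C → h w = 0)
    (hclose : |∫ w, h w ∂μ - ∫ w, h w ∂ν| ≤ η) (hμ : μ.real {w | K < |w|} ≤ τ)
    (hε : η + τ ≤ ε) : μ B ≤ ν C + ENNReal.ofReal ε := by
  have hi : ∀ (ξ : Measure ℝ) [IsFiniteMeasure ξ], Integrable h ξ := fun ξ _ =>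
    Integrable.of_bound hm.aestronglyMeasurable 1 (Filter.Eventually.of_forall fun w => by
      rw [Real.norm_eq_abs, abs_of_nonneg (h0 w)]; exact h1 w)
  have hKm : MeasurableSet {w : ℝ | |w| ≤ K} := measurableSet_le (by fun_prop) (by fun_prop)
  have e1 : μ.real (B ∩ {w | |w| ≤ K}) ≤ ∫ w, h w ∂μ := by
    rw [← integral_indicator_one (hB.inter hKm)]
    refine integral_mono ((integrable_const _).indicator (hB.inter hKm)) (hi μ) fun w => ?_
    by_cases hw : w ∈ B ∩ {w | |w| ≤ K}
    · simp only [indicator_of_mem hw, Pi.one_apply]; exact (hBh w hw.1 hw.2).ge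
    · simp only [indicator_of_notMem hw]; exact h0 w
  have e2 : ∫ w, h w ∂ν ≤ ν.real C := by
    rw [← integral_indicator_one hC]
    refine integral_mono (hi ν) ((integrable_const _).indicator hC) fun w => ?_
    by_cases hw : w ∈ C
    · simp only [indicator_of_mem hw, Pi.one_apply]; exact h1 w
    · simp only [indicator_of_notMem hw]; exact (hCh w hw).le
  have e3 : μ.real B ≤ μ.real (B ∩ {w | |w| ≤ K}) + μ.real {w | K < |w|} := by
    refine (measureReal_mono ?_).trans (measureReal_union_le _ _)
    intro w hw
    by_cases h' : |w| ≤ K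
    · exact Or.inl ⟨hw, h'⟩
    · exact Or.inr (not_le.1 h')
  have e4 : μ.real B ≤ ν.real C + ε := by
    have := abs_le.1 hclose
    linarith
  have hε0 : 0 ≤ ε := by
    have := (abs_nonneg _).trans hclose
    have := (measureReal_nonneg (μ := μ) (s := {w | K < |w|})).trans hμ
    linarith
  rw [← ofReal_measureReal (μ := μ), ← ofReal_measureReal (μ := ν),
    ← ENNReal.ofReal_add measureReal_nonneg hε0]
  exact ENNReal.ofReal_le_ofReal e4

lemma exists_tests (K ε : ℝ) (hε : 0 < ε) :
    ∃ (ι : Type) (_ : Fintype ι) (h : ι → ℝ → ℝ) (L : ℝ), 0 ≤ L ∧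
      (∀ i w, 0 ≤ h i w) ∧ (∀ i w, h i w ≤ 1) ∧ (∀ i, Measurable (h i)) ∧
      (∀ i w w', |h i w - h i w'| ≤ L * |w - w'|) ∧
      ∀ (μ ν : Measure ℝ) [IsFiniteMeasure μ] [IsFiniteMeasure ν] (η τ : ℝ), η + τ ≤ ε →
        (∀ i, |∫ w, h i w ∂μ - ∫ w, h i w ∂ν| ≤ η) → μ.real {w | K < |w|} ≤ τ →
        ν.real {w | K < |w|} ≤ τ → levyProkhorovDist μ ν ≤ ε := by
  have hδ : 0 < ε / 3 := by positivity
  obtain ⟨t0, -, ht0, hcov⟩ := (isCompact_Icc : IsCompact (Icc (-K) K)).finite_cover_balls hδ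
  lift t0 to Finset ℝ using ht0 with t
  let E : Finset t → Set ℝ := fun J => ⋃ x ∈ J, Metric.ball (x : ℝ) (ε / 3)
  refine ⟨Finset t, inferInstance, fun J w => (thickenedIndicator hδ (E J) w : ℝ),
    (((ε/3).toNNReal⁻¹ : ℝ≥0) : ℝ), by positivity, fun i w => by positivity, fun i w => ?_, fun i => ?_, ?_, ?_⟩
  · exact_mod_cast thickenedIndicator_le_one hδ _ _
  · exact (NNReal.continuous_coe.comp (thickenedIndicator hδ (E i)).continuous).measurable
  · intro i w w'
    have := (lipschitzWith_thickenedIndicator hδ (E i)).dist_le_mul w w'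
    simpa [NNReal.dist_eq, Real.dist_eq] using this
  · intro μ ν _ _ η τ hητ hi hμ hν
    have key : ∀ B : Set ℝ, MeasurableSet B → ∃ J : Finset t,
        (∀ w ∈ B, |w| ≤ K → (thickenedIndicator hδ (E J) w : ℝ) = 1) ∧
        (∀ w, w ∉ Metric.thickening ε B → (thickenedIndicator hδ (E J) w : ℝ) = 0) := by
      intro B hB
      classical
      refine ⟨Finset.univ.filter fun x => (Metric.ball (x : ℝ) (ε/3) ∩ B).Nonempty, ?_, ?_⟩
      · intro w hw hwK
        have : w ∈ ⋃ x ∈ (t : Set ℝ), Metric.ball x (ε/3) := hcov (abs_le.1 hwK)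
        simp only [mem_iUnion] at this
        obtain ⟨x, hx, hxw⟩ := this
        have : w ∈ E (Finset.univ.filter fun x => (Metric.ball (x : ℝ) (ε/3) ∩ B).Nonempty) := by
          simp only [E, mem_iUnion]
          exact ⟨⟨x, hx⟩, Finset.mem_filter.2 ⟨Finset.mem_univ _, w, hxw, hw⟩, hxw⟩
        rw [thickenedIndicator_one hδ _ this]; rfl
      · intro w hw
        rw [thickenedIndicator_zero hδ]
        · rfl
        · intro hw'
          apply hw
          rw [Metric.mem_thickening_iff] at hw' ⊢
          obtain ⟨z, hz, hwz⟩ := hw'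
          simp only [E, mem_iUnion] at hz
          obtain ⟨x, hx, hzx⟩ := hz
          obtain ⟨y, hyx, hyB⟩ := (Finset.mem_filter.1 hx).2
          refine ⟨y, hyB, ?_⟩
          rw [Metric.mem_ball] at hzx hyx
          have := dist_triangle4 w z x y
          rw [dist_comm (x : ℝ) y] at this
          linarith
    refine ENNReal.toReal_le_of_le_ofReal hε.le ?_
    refine levyProkhorovEDist_le_of_forall _ _ _ ?_
    intro ε' B hε' hε'' hB
    have hle : ε ≤ ε'.toReal := (ENNReal.ofReal_le_iff_le_toReal hε''.ne).1 hε'.le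
    have hth : Metric.thickening ε B ⊆ Metric.thickening ε'.toReal B :=
      Metric.thickening_mono hle _
    obtain ⟨J, hJ1, hJ2⟩ := key B hB
    constructor
    · refine (lp_half (fun w => (thickenedIndicator hδ (E J) w : ℝ)) ?_ ?_ ?_ μ ν K τ η ε B (Metric.thickening ε B) hB
        Metric.isOpen_thickening.measurableSet hJ1 hJ2 (hi J) hμ hητ).trans (add_le_add (measure_mono hth) hε'.le)
      · exact (NNReal.continuous_coe.comp (thickenedIndicator hδ (E J)).continuous).measurable
      · intro w; positivity
      · intro w; exact_mod_cast thickenedIndicator_le_one hδ _ _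
    · refine (lp_half (fun w => (thickenedIndicator hδ (E J) w : ℝ)) ?_ ?_ ?_ ν μ K τ η ε B (Metric.thickening ε B) hB
        Metric.isOpen_thickening.measurableSet hJ1 hJ2 (by rw [abs_sub_comm]; exact hi J) hν hητ).trans (add_le_add (measure_mono hth) hε'.le)
      · exact (NNReal.continuous_coe.comp (thickenedIndicator hδ (E J)).continuous).measurable
      · intro w; positivity
      · intro w; exact_mod_cast thickenedIndicator_le_one hδ _ _



lemma graphonInt_eq {Ω₂ : Type*} [MeasurableSpace Ω₂] (P₂ : Measure Ω₂) [IsProbabilityMeasure P₂]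
    (U : unitInterval × unitInterval × Ω₂ → ℝ) (hU : Measurable U) (S T : Set unitInterval)
    (hS : MeasurableSet S) (hT : MeasurableSet T) :
    graphonInt (assocGraphon P₂ U) (S ×ˢ T) =
      (((volume : Measure unitInterval).prod ((volume : Measure unitInterval).prod P₂)).restrict
        (S ×ˢ T ×ˢ univ)).map U := by
  have hUm : Measurable fun z : (unitInterval × unitInterval) × Ω₂ => U (z.1.1, z.1.2, z.2) := by
    fun_prop
  have hk : Measurable (assocGraphon P₂ U) := by
    refine Measure.measurable_of_measurable_coe _ fun B hB => ?_
    have := measurable_measure_prodMk_left (ν := P₂) (hUm hB)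
    convert this using 2 with x
    rw [assocGraphon, Measure.map_apply (by fun_prop) hB]
    rfl
  ext B hB
  rw [graphonInt, Measure.bind_apply hB hk.aemeasurable, Measure.map_apply hU hB,
    Measure.restrict_apply (hU hB)]
  have e : ∀ x, assocGraphon P₂ U x B = P₂ (Prod.mk x ⁻¹'
      ((fun z : (unitInterval × unitInterval) × Ω₂ => U (z.1.1, z.1.2, z.2)) ⁻¹' B)) := by
    intro x
    rw [assocGraphon, Measure.map_apply (by fun_prop) hB]
    rfl
  simp_rw [e]
  rw [← Measure.prod_apply (hUm hB)]
  have mp := measurePreserving_prodAssoc (volume : Measure unitInterval) (volume : Measure unitInterval) P₂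
  have : (((volume : Measure unitInterval).prod (volume : Measure unitInterval)).restrict (S ×ˢ T)).prod P₂
      = (((volume : Measure unitInterval).prod (volume : Measure unitInterval)).prod P₂).restrict ((S ×ˢ T) ×ˢ univ) := by
    have h' := Measure.prod_restrict (μ := (volume : Measure unitInterval).prod
      (volume : Measure unitInterval)) (ν := P₂) (S ×ˢ T) univ
    rwa [Measure.restrict_univ] at h'
  rw [this, Measure.restrict_apply (hUm hB), ← mp.measure_preimage]
  · congr 1
    ext ⟨⟨x, y⟩, z⟩
    simp [MeasurableEquiv.prodAssoc, and_assoc]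
  · exact ((hU hB).inter (hS.prod (hT.prod MeasurableSet.univ))).nullMeasurableSet

lemma graphonInt_int {Ω₂ : Type*} [MeasurableSpace Ω₂] (P₂ : Measure Ω₂) [IsProbabilityMeasure P₂]
    (U : unitInterval × unitInterval × Ω₂ → ℝ) (hU : Measurable U) (S T : Set unitInterval)
    (hS : MeasurableSet S) (hT : MeasurableSet T) (h : ℝ → ℝ) (hm : Measurable h) :
    ∫ w, h w ∂(graphonInt (assocGraphon P₂ U) (S ×ˢ T)) =
      ∫ x, (S ×ˢ T ×ˢ univ).indicator (fun x => h (U x)) x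
        ∂((volume : Measure unitInterval).prod ((volume : Measure unitInterval).prod P₂)) := by
  rw [graphonInt_eq P₂ U hU S T hS hT, integral_map hU.aemeasurable hm.aestronglyMeasurable,
    integral_indicator (hS.prod (hT.prod MeasurableSet.univ))]

lemma graphonInt_fin {Ω₂ : Type*} [MeasurableSpace Ω₂] (P₂ : Measure Ω₂) [IsProbabilityMeasure P₂]
    (U : unitInterval × unitInterval × Ω₂ → ℝ) (hU : Measurable U) (S T : Set unitInterval)
    (hS : MeasurableSet S) (hT : MeasurableSet T) :
    IsFiniteMeasure (graphonInt (assocGraphon P₂ U) (S ×ˢ T)) := by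
  rw [graphonInt_eq P₂ U hU S T hS hT]; infer_instance

lemma graphonInt_tail {Ω₂ : Type*} [MeasurableSpace Ω₂] (P₂ : Measure Ω₂) [IsProbabilityMeasure P₂]
    (U : unitInterval × unitInterval × Ω₂ → ℝ) (hU : Measurable U) (S T : Set unitInterval)
    (hS : MeasurableSet S) (hT : MeasurableSet T) (K τ : ℝ) (hτ : 0 ≤ τ)
    (ht : ((volume : Measure unitInterval).prod ((volume : Measure unitInterval).prod P₂))
      {x | K < |U x|} < ENNReal.ofReal τ) :
    (graphonInt (assocGraphon P₂ U) (S ×ˢ T)).real {w | K < |w|} ≤ τ := by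
  refine ENNReal.toReal_le_of_le_ofReal hτ ?_
  rw [graphonInt_eq P₂ U hU S T hS hT, Measure.map_apply hU (measurableSet_lt (by fun_prop) (by fun_prop))]
  exact (Measure.restrict_apply_le _ _).trans ht.le

lemma mp_triple {Ω₂ : Type*} [MeasurableSpace Ω₂] (P₂ : Measure Ω₂) [IsProbabilityMeasure P₂]
    (φ : unitInterval ≃ᵐ unitInterval) (hφ : MeasurePreserving φ (volume : Measure unitInterval) volume) :
    MeasurePreserving (fun x : unitInterval × unitInterval × Ω₂ => (φ x.1, φ x.2.1, x.2.2))
      ((volume : Measure unitInterval).prod ((volume : Measure unitInterval).prod P₂))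
      ((volume : Measure unitInterval).prod ((volume : Measure unitInterval).prod P₂)) :=
  hφ.prod (hφ.prod (MeasurePreserving.id P₂))

lemma int_triple {Ω₂ : Type*} [MeasurableSpace Ω₂] (P₂ : Measure Ω₂) [IsProbabilityMeasure P₂]
    (φ : unitInterval ≃ᵐ unitInterval) (hφ : MeasurePreserving φ (volume : Measure unitInterval) volume)
    (S T : Set unitInterval) (hS : MeasurableSet S) (hT : MeasurableSet T)
    (g : unitInterval × unitInterval × Ω₂ → ℝ) (hg : Measurable g) :
    ∫ x, (S ×ˢ T ×ˢ univ).indicator (fun x : unitInterval × unitInterval × Ω₂ => g (φ x.1, φ x.2.1, x.2.2)) x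
        ∂((volume : Measure unitInterval).prod ((volume : Measure unitInterval).prod P₂)) =
    ∫ x, ((φ.symm ⁻¹' S) ×ˢ (φ.symm ⁻¹' T) ×ˢ univ).indicator g x
        ∂((volume : Measure unitInterval).prod ((volume : Measure unitInterval).prod P₂)) := by
  have hm : MeasurableSet ((φ.symm ⁻¹' S) ×ˢ (φ.symm ⁻¹' T) ×ˢ (univ : Set Ω₂)) :=
    (φ.symm.measurable hS).prod ((φ.symm.measurable hT).prod MeasurableSet.univ)
  have mp := mp_triple P₂ φ hφ
  conv_rhs => rw [← mp.map_eq]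
  rw [integral_map mp.measurable.aemeasurable (hg.indicator hm).aestronglyMeasurable]
  congr 1
  ext x
  have hmem : x ∈ S ×ˢ T ×ˢ (univ : Set Ω₂) ↔
      (φ x.1, φ x.2.1, x.2.2) ∈ (φ.symm ⁻¹' S) ×ˢ (φ.symm ⁻¹' T) ×ˢ (univ : Set Ω₂) := by
    simp [Set.mem_prod]
  by_cases hx : x ∈ S ×ˢ T ×ˢ (univ : Set Ω₂)
  · rw [indicator_of_mem hx, indicator_of_mem (hmem.1 hx)]
  · rw [indicator_of_notMem hx, indicator_of_notMem fun h => hx (hmem.2 h)]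



lemma step_close {Ω₂ : Type*} [MeasurableSpace Ω₂] (P₂ : Measure Ω₂) [IsProbabilityMeasure P₂]
    {A : Type*} [MeasurableSpace A] [MeasurableSingletonClass A] [Countable A]
    (b b' : unitInterval → A) (hb : Measurable b) (hb' : Measurable b')
    (c : A → A → ℝ) (D : ℝ) (hD : 0 ≤ D) (hc : ∀ a a', |c a a'| ≤ D) (E : Set (unitInterval × unitInterval × Ω₂)) :
    |∫ x, E.indicator (fun x => c (b x.1) (b x.2.1) - c (b' x.1) (b' x.2.1)) x
      ∂((volume : Measure unitInterval).prod ((volume : Measure unitInterval).prod P₂))| ≤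
      4 * D * volume.real {x | b x ≠ b' x} := by
  set Q := (volume : Measure unitInterval).prod ((volume : Measure unitInterval).prod P₂) with hQ
  have hN : MeasurableSet {x | b x ≠ b' x} := (measurableSet_eq_fun hb hb').compl
  set N := {x | b x ≠ b' x} with hNd
  have hm1 : MeasurableSet (N ×ˢ (univ : Set (unitInterval × Ω₂))) := hN.prod MeasurableSet.univ
  have hm2 : MeasurableSet ((univ : Set unitInterval) ×ˢ N ×ˢ (univ : Set Ω₂)) :=
    MeasurableSet.univ.prod (hN.prod MeasurableSet.univ)
  have i1 : Integrable ((N ×ˢ (univ : Set (unitInterval × Ω₂))).indicator fun _ => 2 * D) Q :=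
    (integrable_const _).indicator hm1
  have i2 : Integrable (((univ : Set unitInterval) ×ˢ N ×ˢ (univ : Set Ω₂)).indicator fun _ => 2 * D) Q :=
    (integrable_const _).indicator hm2
  have := norm_integral_le_of_norm_le (i1.add i2) (f := fun x => E.indicator (fun x => c (b x.1) (b x.2.1) - c (b' x.1) (b' x.2.1)) x) (μ := Q)
    (Filter.Eventually.of_forall fun x => ?_)
  · rw [Real.norm_eq_abs] at this
    refine this.trans (le_of_eq ?_)
    rw [integral_add' i1 i2, integral_indicator_const _ hm1, integral_indicator_const _ hm2]
    have e1 : Q.real (N ×ˢ (univ : Set (unitInterval × Ω₂))) = volume.real N := by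
      rw [hQ, measureReal_prod_prod]; simp
    have e2 : Q.real ((univ : Set unitInterval) ×ˢ N ×ˢ (univ : Set Ω₂)) = volume.real N := by
      rw [hQ, measureReal_prod_prod, measureReal_prod_prod]; simp
    rw [e1, e2]; simp only [smul_eq_mul]; ring
  · have hle : ‖E.indicator (fun x => c (b x.1) (b x.2.1) - c (b' x.1) (b' x.2.1)) x‖ ≤
      |c (b x.1) (b x.2.1) - c (b' x.1) (b' x.2.1)| := norm_indicator_le_norm_self _ _
    refine hle.trans ?_
    have h2 : |c (b x.1) (b x.2.1) - c (b' x.1) (b' x.2.1)| ≤ 2 * D := by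
      refine (abs_sub _ _).trans ?_
      linarith [hc (b x.1) (b x.2.1), hc (b' x.1) (b' x.2.1)]
    have n1 : 0 ≤ (N ×ˢ (univ : Set (unitInterval × Ω₂))).indicator (fun _ => 2 * D) x :=
      indicator_nonneg (fun _ _ => by positivity) _
    have n2 : 0 ≤ ((univ : Set unitInterval) ×ˢ N ×ˢ (univ : Set Ω₂)).indicator (fun _ => 2 * D) x :=
      indicator_nonneg (fun _ _ => by positivity) _
    rw [Pi.add_apply]
    by_cases h1 : x.1 ∈ N
    · have : x ∈ N ×ˢ (univ : Set (unitInterval × Ω₂)) := ⟨h1, mem_univ _⟩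
      rw [indicator_of_mem this]; linarith
    · by_cases h3 : x.2.1 ∈ N
      · have : x ∈ (univ : Set unitInterval) ×ˢ N ×ˢ (univ : Set Ω₂) := ⟨mem_univ _, h3, mem_univ _⟩
        rw [indicator_of_mem this]; linarith
      · have e1 : b x.1 = b' x.1 := not_not.1 h1
        have e3 : b x.2.1 = b' x.2.1 := not_not.1 h3
        rw [e1, e3, sub_self, abs_zero]; positivity

lemma pair_close {Ω₂ : Type*} [MeasurableSpace Ω₂] (P₂ : Measure Ω₂) [IsProbabilityMeasure P₂]
    {ι : Type} [Fintype ι] (h : ι → ℝ → ℝ)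
    (h0 : ∀ i w, 0 ≤ h i w) (h1 : ∀ i w, h i w ≤ 1) (hm : ∀ i, Measurable (h i)) (d : ℕ)
    (U V : unitInterval × unitInterval × Ω₂ → ℝ) (hU : Measurable U) (hV : Measurable V)
    (b b' : unitInterval → Fin d → Bool) (hb : Measurable b) (hb' : Measurable b')
    (c : ι → (Fin d → Bool) → (Fin d → Bool) → ℝ) (hc : ∀ i a a', |c i a a'| ≤ d)
    (η : ℝ) (hη : 0 < η) (hη1 : η ≤ 1) (hoU : En P₂ h (d+2) U ≤ Psi P₂ b U (eF h c) + η ^ 2)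
    (hoV : En P₂ h (d+2) V ≤ Psi P₂ b' V (eF h c) + η ^ 2)
    (φ : unitInterval ≃ᵐ unitInterval) (hφ : MeasurePreserving φ (volume : Measure unitInterval) volume)
    (i : ι) (S T : Set unitInterval) (hS : MeasurableSet S) (hT : MeasurableSet T) :
    |∫ w, h i w ∂(graphonInt (assocGraphon P₂ U) (S ×ˢ T)) -
      ∫ w, h i w ∂(graphonInt (fun x => assocGraphon P₂ V (φ x.1, φ x.2)) (S ×ˢ T))| ≤
      2 * η + 4 * d * volume.real {x | b x ≠ b' (φ x)} := by
  set V' : unitInterval × unitInterval × Ω₂ → ℝ := fun x => V (φ x.1, φ x.2.1, x.2.2) with hV'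
  have hφm := φ.measurable
  have hV'm : Measurable V' := hV.comp (by fun_prop)
  have e : (fun x : unitInterval × unitInterval => assocGraphon P₂ V (φ x.1, φ x.2)) = assocGraphon P₂ V' := rfl
  rw [e, graphonInt_int P₂ U hU S T hS hT _ (hm i), graphonInt_int P₂ V' hV'm S T hS hT _ (hm i)]
  have c1 := cut_close P₂ h h0 h1 hm d U hU b hb c hc η hη hη1 hoU i S T hS hT
  have c2 := cut_close P₂ h h0 h1 hm d V hV b' hb' c hc η hη hη1 hoV i (φ.symm ⁻¹' S) (φ.symm ⁻¹' T)
    (φ.symm.measurable hS) (φ.symm.measurable hT)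
  have mc : ∀ (β : unitInterval → Fin d → Bool), Measurable β →
      Measurable fun x : unitInterval × unitInterval × Ω₂ => c i (β x.1) (β x.2.1) := by
    intro β hβ
    exact (measurable_of_countable (fun p : (Fin d → Bool) × (Fin d → Bool) => c i p.1 p.2)).comp
      ((hβ.comp measurable_fst).prodMk (hβ.comp (measurable_fst.comp measurable_snd)))
  rw [← int_triple P₂ φ hφ S T hS hT (fun x => h i (V x) - c i (b' x.1) (b' x.2.1))
    (((hm i).comp hV).sub (mc b' hb'))] at c2
  have c3 := step_close P₂ b (fun x => b' (φ x)) hb (hb'.comp hφm) (c i) d (by positivity) (hc i) (S ×ˢ T ×ˢ univ)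
  set Q := (volume : Measure unitInterval).prod ((volume : Measure unitInterval).prod P₂) with hQ
  have hE : MeasurableSet (S ×ˢ T ×ˢ (univ : Set Ω₂)) := hS.prod (hT.prod MeasurableSet.univ)
  have ih : ∀ Z : unitInterval × unitInterval × Ω₂ → ℝ, Measurable Z → Integrable (fun x => h i (Z x)) Q :=
    fun Z hZ => Integrable.of_bound ((hm i).comp hZ).aestronglyMeasurable 1
      (Filter.Eventually.of_forall fun x => by
        rw [Real.norm_eq_abs, abs_of_nonneg (h0 _ _)]; exact h1 _ _)
  have ic : ∀ (β : unitInterval → Fin d → Bool), Measurable β →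
      Integrable (fun x : unitInterval × unitInterval × Ω₂ => c i (β x.1) (β x.2.1)) Q :=
    fun β hβ => Integrable.of_bound (mc β hβ).aestronglyMeasurable d
      (Filter.Eventually.of_forall fun x => hc _ _ _)
  have icφ := ic (fun x => b' (φ x)) (hb'.comp hφm)
  rw [integral_indicator hE] at c1 c2 c3 ⊢
  rw [integral_indicator hE]
  rw [integral_sub (ih U hU).integrableOn (ic b hb).integrableOn] at c1
  rw [integral_sub (ih V' hV'm).integrableOn icφ.integrableOn] at c2
  rw [integral_sub (ic b hb).integrableOn icφ.integrableOn] at c3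
  have a1 := abs_le.1 c1
  have a2 := abs_le.1 c2
  have a3 := abs_le.1 c3
  rw [abs_le]
  constructor <;> linarith



lemma exists_small (C ε : ℝ) (hC : 0 ≤ C) (hε : 0 < ε) : ∃ ρ : ℝ, 0 < ρ ∧ ρ ≤ 1/2 ∧ C * ρ ≤ ε := by
  refine ⟨min (1/2) (ε / (C + 1)), by positivity, min_le_left _ _, ?_⟩
  calc C * min (1/2) (ε / (C + 1)) ≤ C * (ε / (C + 1)) := by gcongr; exact min_le_right _ _
    _ = ε * (C / (C + 1)) := by ring
    _ ≤ ε * 1 := by gcongr; rw [div_le_one (by positivity)]; linarith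
    _ = ε := mul_one ε

lemma exists_flat (e : ℕ → ℝ) (M δ : ℝ) (hδ : 0 < δ) (h0 : ∀ k, 0 ≤ e k) (hM : ∀ k, e k ≤ M) :
    ∃ k, e (k + 2) < e k + δ := by
  by_contra hcon
  push Not at hcon
  have : ∀ j : ℕ, (j : ℝ) * δ ≤ e (2 * j) := by
    intro j
    induction j with
    | zero => simpa using h0 0
    | succ j ih =>
      have := hcon (2 * j)
      rw [show 2 * (j + 1) = 2 * j + 2 by ring]
      push_cast
      linarith
  obtain ⟨j, hj⟩ := exists_nat_gt (M / δ)
  rw [div_lt_iff₀ hδ] at hj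
  linarith [this j, hM (2 * j)]

lemma En_tendsto {Ω₂ : Type*} [MeasurableSpace Ω₂] (P₂ : Measure Ω₂) [IsProbabilityMeasure P₂]
    (W : ℕ → unitInterval × unitInterval × Ω₂ → ℝ) (hW : ∀ n, Measurable (W n))
    (hcauchy : ∀ ε > (0 : ℝ), ∃ N : ℕ, ∀ m ≥ N, ∀ n ≥ N,
      dM (PVar.ofUnitInterval P₂ (W m) (hW m))
         (PVar.ofUnitInterval P₂ (W n) (hW n)) < ε)
    {ι : Type} [Fintype ι] (h : ι → ℝ → ℝ) (L : ℝ) (hL : 0 ≤ L)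
    (h0 : ∀ i w, 0 ≤ h i w) (h1 : ∀ i w, h i w ≤ 1) (hm : ∀ i, Measurable (h i))
    (hlip : ∀ i w w', |h i w - h i w'| ≤ L * |w - w'|) (k : ℕ) :
    ∃ e : ℝ, Filter.Tendsto (fun n => En P₂ h (k + 1) (W n)) Filter.atTop (nhds e) := by
  apply cauchySeq_tendsto_of_complete
  rw [Metric.cauchySeq_iff]
  intro ε hε
  obtain ⟨ρ, hρ, hρ2, hρC⟩ := exists_small (Fintype.card ι * (2 * ((k+1 : ℕ):ℝ) * L) +
      2 * (Fintype.card ι * (2 * ((k+1 : ℕ):ℝ) + ((k+1 : ℕ):ℝ)^2))) (ε/2) (by positivity) (by positivity)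
  obtain ⟨N, hN⟩ := haus_transfer P₂ W hW hcauchy k ρ hρ
  refine ⟨N, fun m hm' n hn => ?_⟩
  have t1 := En_transfer P₂ h L hL h0 h1 hm hlip (k+1) (W m) (hW m) (W n) (hW n) ρ hρ hρ2 (hN m hm' n hn)
  have t2 := En_transfer P₂ h L hL h0 h1 hm hlip (k+1) (W n) (hW n) (W m) (hW m) ρ hρ hρ2 (hN n hn m hm')
  rw [Real.dist_eq, abs_lt]
  constructor <;> linarith

lemma main_cauchy
    {Ω₂ : Type*} [MeasurableSpace Ω₂] (P₂ : Measure Ω₂) [IsProbabilityMeasure P₂]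
    (W : ℕ → unitInterval × unitInterval × Ω₂ → ℝ) (hW : ∀ n, Measurable (W n))
      (htight : ∀ ε > (0 : ℝ), ∃ K > (0 : ℝ), ∀ n : ℕ,
        ((volume : Measure unitInterval).prod
          (((volume : Measure unitInterval)).prod P₂)) {x | K < |W n x|}
          < ENNReal.ofReal ε)
    (hcauchy : ∀ ε > (0 : ℝ), ∃ N : ℕ, ∀ m ≥ N, ∀ n ≥ N,
      dM (PVar.ofUnitInterval P₂ (W m) (hW m))
         (PVar.ofUnitInterval P₂ (W n) (hW n)) < ε) :
    ∀ ε > (0 : ℝ), ∃ N : ℕ, ∀ m ≥ N, ∀ n ≥ N,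
      unlabCutDist (assocGraphon P₂ (W m)) (assocGraphon P₂ (W n)) < ε := by
  intro ε hε
  set ε₁ := ε / 2 with hε₁
  have hε₁0 : 0 < ε₁ := by positivity
  obtain ⟨K, hK, hKt⟩ := htight (ε₁ / 2) (by positivity)
  obtain ⟨ι, _, h, L, hL, h0, h1, hm, hlip, hLP⟩ := exists_tests K ε₁ hε₁0
  set η := min 1 (ε₁ / 8) with hη
  have hη0 : 0 < η := by positivity
  have hη1 : η ≤ 1 := min_le_left _ _
  have hη2 : η ≤ ε₁ / 8 := min_le_right _ _
  set δ := η ^ 2 / 6 with hδ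
  have hδ0 : 0 < δ := by positivity
  have hlim := En_tendsto P₂ W hW hcauchy h L hL h0 h1 hm hlip
  choose e he using hlim
  obtain ⟨k, hk⟩ := exists_flat e (Fintype.card ι) δ hδ0
    (fun k => ge_of_tendsto' (he k) fun n => En_nonneg P₂ h h0 h1 hm (k+1) (W n) (hW n))
    (fun k => le_of_tendsto' (he k) fun n => En_le P₂ h h0 h1 hm (k+1) (W n) (hW n))
  set d := k + 1 with hd
  set CL : ℝ := Fintype.card ι * (2 * (d:ℝ) * L) with hCL
  set CM : ℝ := Fintype.card ι * (2 * (d:ℝ) + (d:ℝ)^2) with hCM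
  set CA : ℝ := 4 * d * ((2 + 3 * Fintype.card (Fin d → Bool)) * 2) with hCA
  have hCL0 : 0 ≤ CL := by positivity
  have hCM0 : 0 ≤ CM := by positivity
  have hCA0 : 0 ≤ CA := by positivity
  obtain ⟨ρ₁, hρ₁, -, hρ₁C⟩ := exists_small (CL + 2 * CM) δ (by positivity) hδ0
  obtain ⟨ρ₂, hρ₂, hρ₂h, hρ₂C⟩ := exists_small CA (ε₁ / 8) hCA0 (by positivity)
  set ρ := min ρ₁ ρ₂ with hρd
  have hρ : 0 < ρ := lt_min hρ₁ hρ₂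
  have hρh : ρ ≤ 1/2 := (min_le_right _ _).trans hρ₂h
  have hρC : (CL + 2 * CM) * ρ ≤ δ := le_trans (by gcongr; exact min_le_left _ _) hρ₁C
  have hρA : CA * ρ ≤ ε₁ / 8 := le_trans (by gcongr; exact min_le_right _ _) hρ₂C
  obtain ⟨N1, hN1⟩ := Metric.tendsto_atTop.1 (he k) δ hδ0
  obtain ⟨N2, hN2⟩ := Metric.tendsto_atTop.1 (he (k+2)) δ hδ0
  obtain ⟨N3, hN3⟩ := haus_transfer P₂ W hW hcauchy k ρ hρ
  refine ⟨max N1 (max N2 N3), fun m hm' n hn' => ?_⟩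
  simp only [ge_iff_le, max_le_iff] at hm' hn'
  have em1 := abs_lt.1 (Real.dist_eq _ _ ▸ hN1 m hm'.1)
  have em2 := abs_lt.1 (Real.dist_eq _ _ ▸ hN2 m hm'.2.1)
  have en2 := abs_lt.1 (Real.dist_eq _ _ ▸ hN2 n hn'.2.1)
  change -δ < En P₂ h (d + 2) (W m) - e (k+2) ∧ En P₂ h (d + 2) (W m) - e (k+2) < δ at em2
  change -δ < En P₂ h (d + 2) (W n) - e (k+2) ∧ En P₂ h (d + 2) (W n) - e (k+2) < δ at en2
  obtain ⟨t, ⟨b, hb, c, hc, rfl⟩, hbt⟩ := exists_lt_of_lt_csSup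
    (show (EnSet P₂ h d (W m)).Nonempty from ⟨_, EnSet_zero P₂ h d (W m)⟩)
    (show En P₂ h d (W m) - δ < sSup (EnSet P₂ h d (W m)) from sub_lt_self _ hδ0)
  obtain ⟨b', hb', hF⟩ := bool_transfer P₂ (W m) (W n) (hW m) (hW n) ρ hρ hρh
    (hN3 m hm'.2.2 n hn'.2.2) b hb
  have hE := abs_le.1 ((hF (eF h c) CL CM hCL0 (eF_meas h hm d c) (eF_lip h L hlip d c hc)
    (eF_abs h h0 h1 d c hc)).trans hρC)
  have hmarg : ∀ a, |volume.real (b ⁻¹' {a}) - volume.real (b' ⁻¹' {a})| ≤ 2 * ρ := by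
    intro a
    classical
    have hP : ∀ (β : unitInterval → Fin d → Bool), Measurable β →
        ∀ U : unitInterval × unitInterval × Ω₂ → ℝ,
        Psi P₂ β U (fun a₁ _ _ => if a₁ = a then 1 else 0) = volume.real (β ⁻¹' {a}) := by
      intro β hβ U
      have hs : MeasurableSet ((β ⁻¹' {a}) ×ˢ (univ : Set (unitInterval × Ω₂))) :=
        (hβ (measurableSet_singleton a)).prod MeasurableSet.univ
      have : (fun x : unitInterval × unitInterval × Ω₂ => if β x.1 = a then (1:ℝ) else 0) =
          ((β ⁻¹' {a}) ×ˢ (univ : Set (unitInterval × Ω₂))).indicator 1 := by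
        ext x
        simp [indicator]
      rw [Psi, this, integral_indicator_one hs, measureReal_prod_prod]
      simp
    have := hF (fun a₁ _ _ => if a₁ = a then 1 else 0) 0 1 le_rfl (fun _ _ => measurable_const)
      (fun _ _ _ _ => by simp) (fun a₁ _ _ => by split_ifs <;> simp)
    rw [hP b hb, hP b' hb'] at this
    linarith
  obtain ⟨φ, hφ, hφd⟩ := exists_align b b' hb hb' (2 * ρ) (by positivity) hmarg
  have hoU : En P₂ h (d+2) (W m) ≤ Psi P₂ b (W m) (eF h c) + η ^ 2 := by
    have : η ^ 2 = 6 * δ := by rw [hδ]; ring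
    linarith [em1.1, em1.2]
  have hoV : En P₂ h (d+2) (W n) ≤ Psi P₂ b' (W n) (eF h c) + η ^ 2 := by
    have : η ^ 2 = 6 * δ := by rw [hδ]; ring
    linarith [em1.1, em1.2]
  have hcut : cutDistKer (assocGraphon P₂ (W m))
      (fun x => assocGraphon P₂ (W n) (φ x.1, φ x.2)) ≤ ε₁ := by
    refine Real.iSup_le (fun p => ?_) hε₁0.le
    obtain ⟨⟨S, hS⟩, ⟨T, hT⟩⟩ := p
    set V' : unitInterval × unitInterval × Ω₂ → ℝ := fun x => W n (φ x.1, φ x.2.1, x.2.2) with hV'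
    have hφm := φ.measurable
    have hV'm : Measurable V' := (hW n).comp (by fun_prop)
    have e' : (fun x : unitInterval × unitInterval => assocGraphon P₂ (W n) (φ x.1, φ x.2)) =
      assocGraphon P₂ V' := rfl
    have hp := fun i => pair_close P₂ h h0 h1 hm d (W m) (W n) (hW m) (hW n) b b' hb hb' c hc η hη0 hη1
      hoU hoV φ hφ i S T hS hT
    rw [e'] at hp ⊢
    have f1 := graphonInt_fin P₂ (W m) (hW m) S T hS hT
    have f2 := graphonInt_fin P₂ V' hV'm S T hS hT
    refine hLP _ _ (ε₁ / 2) (ε₁ / 2) (by linarith) (fun i => (hp i).trans ?_)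
      (graphonInt_tail P₂ (W m) (hW m) S T hS hT K (ε₁/2) (by positivity) (hKt m))
      (graphonInt_tail P₂ V' hV'm S T hS hT K (ε₁/2) (by positivity) ?_)
    · have : 4 * (d:ℝ) * volume.real {x | b x ≠ b' (φ x)} ≤ CA * ρ := by
        calc _ ≤ 4 * (d:ℝ) * ((2 + 3 * Fintype.card (Fin d → Bool)) * (2 * ρ)) := by gcongr
          _ = CA * ρ := by rw [hCA]; ring
      linarith
    · have := (mp_triple P₂ φ hφ).measure_preimage (s := {x | K < |W n x|})
        (measurableSet_lt measurable_const (hW n).abs).nullMeasurableSet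
      calc _ = _ := this
        _ < _ := hKt n
  have hbdd : BddBelow (range fun φ : {φ : unitInterval ≃ᵐ unitInterval //
          MeasurePreserving φ (volume : Measure unitInterval) volume} =>
      cutDistKer (assocGraphon P₂ (W m)) fun x => assocGraphon P₂ (W n) (φ.1 x.1, φ.1 x.2)) := by
    refine ⟨0, ?_⟩
    rintro _ ⟨ψ, rfl⟩
    exact Real.iSup_nonneg fun p => ENNReal.toReal_nonneg
  calc unlabCutDist (assocGraphon P₂ (W m)) (assocGraphon P₂ (W n)) ≤ _ := ciInf_le hbdd ⟨φ, hφ⟩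
    _ ≤ ε₁ := hcut
    _ < ε := by rw [hε₁]; linarith


/-- If a tight sequence of P-variables on `[0,1] × [0,1] × Ω₂` is
Cauchy for the P-variables metric `d_M`, then the associated probability graphons form
a Cauchy sequence for the unlabelled cut distance `δ_□`. -/
theorem unlabCutDist_cauchy_of_dM_cauchy
    {Ω₂ : Type*} [MeasurableSpace Ω₂] (P₂ : Measure Ω₂) [IsProbabilityMeasure P₂]
    (W : ℕ → unitInterval × unitInterval × Ω₂ → ℝ) (hW : ∀ n, Measurable (W n))
      (htight : ∀ ε > (0 : ℝ), ∃ K > (0 : ℝ), ∀ n : ℕ,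
        ((volume : Measure unitInterval).prod
          (((volume : Measure unitInterval)).prod P₂)) {x | K < |W n x|}
          < ENNReal.ofReal ε)
    (hcauchy : ∀ ε > (0 : ℝ), ∃ N : ℕ, ∀ m ≥ N, ∀ n ≥ N,
      dM (PVar.ofUnitInterval P₂ (W m) (hW m))
         (PVar.ofUnitInterval P₂ (W n) (hW n)) < ε) :
    ∀ ε > (0 : ℝ), ∃ N : ℕ, ∀ m ≥ N, ∀ n ≥ N,
      unlabCutDist (assocGraphon P₂ (W m)) (assocGraphon P₂ (W n)) < ε := by
  exact main_cauchy P₂ W hW htight hcauchy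

end
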